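/- Let α > 0 be a real number. Then as x → ∞, Σ_{x^{1/3} < p₃ ≤ x^{1/3}(log x)^{4/α}, p₃ prime} p₃^{-α} Σ_{p₂ ≤ √(x/p₃), p₂ prime} Σ_{p₁ < p₂, p₁ prime} p₁^{α} = (18/(α(α+1)(α+2)))·x/(log x)^3 + O(x/(log x)^4). -/

import Mathlib

section

open Filter MeasureTheory Set Complex Topology
open scoped FourierTransform SchwartzMap ContDiff

/-- The Mellin transform of the fractional part restricted to `(1, ∞)`. -/
noncomputable def fractTail (t : ℝ) : ℂ :=
  (Set.Ioi (1:ℝ)).indicator (fun t => ((Int.fract t : ℝ) : ℂ)) t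

lemma measurable_fractTail : Measurable fractTail := by
  unfold fractTail
  exact (Complex.measurable_ofReal.comp measurable_fract).indicator measurableSet_Ioi

lemma norm_fractTail_le (t : ℝ) : ‖fractTail t‖ ≤ 1 := by
  unfold fractTail
  by_cases h : t ∈ Set.Ioi (1:ℝ)
  · rw [Set.indicator_of_mem h, Complex.norm_real, Real.norm_of_nonneg (Int.fract_nonneg t)]
    exact (Int.fract_lt_one t).le
  · rw [Set.indicator_of_notMem h]; simp

lemma fractTail_of_le {t : ℝ} (ht : t ≤ 1) : fractTail t = 0 := by
  unfold fractTail
  rw [Set.indicator_of_notMem]; simpa using ht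

lemma fractTail_of_gt {t : ℝ} (ht : 1 < t) : fractTail t = ((Int.fract t : ℝ) : ℂ) := by
  unfold fractTail
  rw [Set.indicator_of_mem]; simpa using ht

/-- The Mellin transform of `fractTail` at `-s` is holomorphic for `Re s > 0`. -/
lemma differentiableAt_mellin_fractTail {s : ℂ} (hs : 0 < s.re) :
    DifferentiableAt ℂ (fun s => mellin fractTail (-s)) s := by
  have h : DifferentiableAt ℂ (mellin fractTail) (-s) := by
    apply mellin_differentiableAt_of_isBigO_rpow (a := 0) (b := (-s).re - 1)
    · apply LocallyIntegrable.locallyIntegrableOn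
      have : LocallyIntegrable (fun _ : ℝ => (1:ℝ)) := locallyIntegrable_const 1
      refine this.mono measurable_fractTail.aestronglyMeasurable ?_
      exact Eventually.of_forall fun x => by simpa using norm_fractTail_le x
    · apply Asymptotics.IsBigO.of_bound 1
      exact Eventually.of_forall fun x => by simpa using norm_fractTail_le x
    · simpa using hs
    · apply Asymptotics.IsBigO.of_bound 1
      filter_upwards [mem_nhdsWithin_of_mem_nhds (Iio_mem_nhds zero_lt_one)] with t ht
      rw [fractTail_of_le (le_of_lt ht)]
      simp
    · linarith
  exact h.comp s differentiableAt_id.neg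

lemma integrableOn_rpow_mul_fract {s : ℂ} (hs : 0 < s.re) {c : ℝ} (hc : 1 ≤ c) :
    IntegrableOn (fun t : ℝ => ((Int.fract t : ℝ) : ℂ) * (t:ℂ) ^ (-s - 1)) (Ioi c) := by
  have h1 : IntegrableOn (fun t : ℝ => t ^ (-s.re - 1)) (Ioi c) :=
    integrableOn_Ioi_rpow_of_lt (by linarith) (by linarith)
  refine Integrable.mono h1 ?_ ?_
  · refine AEStronglyMeasurable.mul ?_ ?_
    · exact (Complex.measurable_ofReal.comp measurable_fract).aestronglyMeasurable
    · refine ContinuousOn.aestronglyMeasurable ?_ measurableSet_Ioi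
      intro t ht
      have : (0:ℝ) < t := by have := mem_Ioi.1 ht; linarith
      exact (continuousAt_ofReal_cpow_const _ _ (Or.inr this.ne')).continuousWithinAt
  · filter_upwards [ae_restrict_mem measurableSet_Ioi] with t ht
    have h0 : (0:ℝ) < t := by have := mem_Ioi.1 ht; linarith
    rw [norm_mul, Complex.norm_real, norm_cpow_eq_rpow_re_of_pos h0,
      Real.norm_of_nonneg (Int.fract_nonneg t), Real.norm_of_nonneg (by positivity)]
    simp only [sub_re, neg_re, one_re]
    have := (Int.fract_lt_one t).le
    have h2 : 0 ≤ t ^ (-s.re - 1) := by positivity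
    nlinarith

lemma mellin_fractTail_eq (s : ℂ) :
    mellin fractTail (-s) = ∫ t in Ioi (1:ℝ), ((Int.fract t : ℝ) : ℂ) * (t:ℂ) ^ (-s - 1) := by
  rw [mellin]
  have : (fun t : ℝ => (t:ℂ) ^ (-s - 1) • fractTail t) =
      (Ioi (1:ℝ)).indicator (fun t : ℝ => ((Int.fract t : ℝ) : ℂ) * (t:ℂ) ^ (-s - 1)) := by
    ext t
    by_cases h : 1 < t
    · rw [indicator_of_mem (mem_Ioi.2 h), fractTail_of_gt h, smul_eq_mul, mul_comm]
    · rw [indicator_of_notMem (by simpa using h), fractTail_of_le (not_lt.1 h), smul_zero]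
  rw [this, setIntegral_indicator measurableSet_Ioi]
  congr 2
  rw [Set.inter_eq_right]; exact Ioi_subset_Ioi zero_le_one

lemma riemannZeta_eq_sub_integral_fract_of_one_lt {s : ℂ} (hs : 1 < s.re) :
    riemannZeta s = s / (s - 1) - s * mellin fractTail (-s) := by
  have h1 : s ≠ 1 := by rintro rfl; simp at hs
  rw [← LSeries_one_eq_riemannZeta hs, LSeries_eq_mul_integral' 1 zero_le_one hs,
    mellin_fractTail_eq]
  · have hi : IntegrableOn (fun t : ℝ => (t:ℂ) ^ (-s)) (Ioi 1) :=
      integrableOn_Ioi_cpow_of_lt (by simpa using hs) one_pos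
    have h2 := integral_Ioi_cpow_of_lt (a := -s) (by simpa using hs) one_pos
    have h3 : ∫ t in Ioi (1:ℝ), (∑ k ∈ Finset.Icc 1 ⌊t⌋₊, (1 : ℕ → ℂ) k) * (t:ℂ) ^ (-(s + 1)) =
      ∫ t in Ioi (1:ℝ), ((t:ℂ) ^ (-s) - ((Int.fract t : ℝ) : ℂ) * (t:ℂ) ^ (-s - 1)) := by
      apply setIntegral_congr_fun measurableSet_Ioi
      intro t ht
      have ht0 : (0:ℝ) < t := by have := mem_Ioi.1 ht; linarith
      have e1 : (t:ℂ) ^ (-s) = t * (t:ℂ) ^ (-s - 1) := by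
        rw [cpow_sub _ _ (by exact_mod_cast ht0.ne'), cpow_one]
        have : (t:ℂ) ≠ 0 := by exact_mod_cast ht0.ne'
        field_simp
      simp only [Pi.one_apply, Finset.sum_const, Nat.card_Icc, add_tsub_cancel_right, nsmul_eq_mul, mul_one]
      rw [e1, ← sub_mul, show -(s+1) = -s - 1 by ring]
      congr 1
      have : (t : ℝ) - Int.fract t = ⌊t⌋₊ := by
        rw [Int.self_sub_fract, natCast_floor_eq_intCast_floor ht0.le]
      exact_mod_cast this.symm
    rw [h3, integral_sub hi (integrableOn_rpow_mul_fract (by linarith) le_rfl), h2]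
    simp only [ofReal_one, one_cpow]
    have : s - 1 ≠ 0 := sub_ne_zero.2 h1
    have : -s + 1 ≠ 0 := by intro h; apply this; linear_combination -h
    field_simp
    ring_nf
  · apply Asymptotics.IsBigO.of_bound 1
    exact Eventually.of_forall fun n => by simp

lemma riemannZeta_eq_sub_integral_fract {s : ℂ} (hs : 0 < s.re) (h1 : s ≠ 1) :
    riemannZeta s = s / (s - 1) - s * mellin fractTail (-s) := by
  have key : EqOn riemannZeta₁ (fun s => s - (s - 1) * (s * mellin fractTail (-s))) {s | 0 < s.re} := by
    refine AnalyticOnNhd.eqOn_of_preconnected_of_eventuallyEq (𝕜 := ℂ) (z₀ := 2) ?_ ?_ ?_ ?_ ?_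
    · exact differentiable_riemannZeta₁.differentiableOn.analyticOnNhd
        (isOpen_lt continuous_const continuous_re)
    · apply DifferentiableOn.analyticOnNhd _ (isOpen_lt continuous_const continuous_re)
      intro z hz
      have := (differentiableAt_mellin_fractTail hz)
      apply DifferentiableAt.differentiableWithinAt
      fun_prop
    · exact (convex_halfSpace_re_gt 0).isPreconnected
    · simp
    · filter_upwards [(isOpen_lt continuous_const continuous_re).mem_nhds
        (show (2:ℂ) ∈ {s : ℂ | 1 < s.re} by simp)] with z hz
      have hz1 : z ≠ 1 := by rintro rfl; simp at hz
      have hz2 : z - 1 ≠ 0 := sub_ne_zero.2 hz1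
      have e1 := riemannZeta_eq_inv_sub_mul hz1
      rw [riemannZeta_eq_sub_integral_fract_of_one_lt hz] at e1
      field_simp at e1
      rw [← e1]; ring
  have hz2 : s - 1 ≠ 0 := sub_ne_zero.2 h1
  rw [riemannZeta_eq_inv_sub_mul h1, key hs]
  field_simp

lemma sum_cpow_eq_sub_integral {s : ℂ} (h1 : s ≠ 1) (hs0 : s ≠ 0) {N : ℕ} (hN : 1 ≤ N) :
    ∑ n ∈ Finset.Icc 1 N, (n:ℂ) ^ (-s) = s / (s - 1) - (N:ℂ) ^ (1 - s) / (s - 1)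
      - s * ∫ t in Ioc (1:ℝ) N, ((Int.fract t : ℝ) : ℂ) * (t:ℂ) ^ (-s - 1) := by
  have hN' : (1:ℝ) ≤ N := by exact_mod_cast hN
  have hz2 : s - 1 ≠ 0 := sub_ne_zero.2 h1
  have hd : ∀ t : ℝ, 1 ≤ t → HasDerivAt (fun t : ℝ => (t:ℂ) ^ (-s)) (-s * (t:ℂ) ^ (-s - 1)) t := by
    intro t ht
    exact hasDerivAt_ofReal_cpow_const (by linarith) (neg_ne_zero.2 hs0)
  have hc : ∀ z : ℂ, ContinuousOn (fun t : ℝ => (t:ℂ) ^ z) (Icc 1 (N:ℝ)) := by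
    intro z t ht
    have : (0:ℝ) < t := by have := ht.1; linarith
    exact (continuousAt_ofReal_cpow_const _ _ (Or.inr this.ne')).continuousWithinAt
  have hI : ∀ z : ℂ, IntegrableOn (fun t : ℝ => (t:ℂ) ^ z) (Ioc 1 (N:ℝ)) := fun z =>
    ((hc z).integrableOn_compact isCompact_Icc).mono_set Ioc_subset_Icc_self
  have abel := sum_mul_eq_sub_sub_integral_mul (f := fun t : ℝ => (t:ℂ) ^ (-s)) (fun _ => (1:ℂ))
    zero_le_one hN' (fun t ht => (hd t ht.1).differentiableAt) (by
      refine IntegrableOn.congr_fun (f := fun t : ℝ => -s * (t:ℂ) ^ (-s - 1)) ?_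
        (fun t ht => ((hd t ht.1).deriv).symm) measurableSet_Icc
      exact ((continuousOn_const.mul (hc _)).integrableOn_compact isCompact_Icc))
  have e2 : ∫ t in Ioc (1:ℝ) N, deriv (fun t : ℝ => (t:ℂ) ^ (-s)) t *
        ∑ k ∈ Finset.Icc 0 ⌊t⌋₊, (1:ℂ) = ∫ t in Ioc (1:ℝ) N,
        ((-s) * (t:ℂ) ^ (-s) + (-s) * (t:ℂ)^(-s-1)
          + s * (((Int.fract t : ℝ) : ℂ) * (t:ℂ) ^ (-s - 1))) := by
    apply setIntegral_congr_fun measurableSet_Ioc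
    intro t ht
    have ht0 : (0:ℝ) < t := by have := ht.1; linarith
    have e1 : (t:ℂ) ^ (-s) = t * (t:ℂ) ^ (-s - 1) := by
      rw [cpow_sub _ _ (by exact_mod_cast ht0.ne'), cpow_one]
      have : (t:ℂ) ≠ 0 := by exact_mod_cast ht0.ne'
      field_simp
    have e3 : ((⌊t⌋₊ : ℕ) : ℂ) = t - ((Int.fract t : ℝ) : ℂ) := by
      have : (t : ℝ) - Int.fract t = ⌊t⌋₊ := by
        rw [Int.self_sub_fract, natCast_floor_eq_intCast_floor ht0.le]
      exact_mod_cast this.symm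
    simp only [(hd t ht.1.le).deriv, Finset.sum_const, Nat.card_Icc, nsmul_eq_mul, mul_one]
    push_cast
    rw [e1, e3]
    ring
  have hfr : IntegrableOn (fun t : ℝ => ((Int.fract t : ℝ) : ℂ) * (t:ℂ) ^ (-s - 1)) (Ioc 1 (N:ℝ)) := by
    refine Integrable.mono (hI (-s - 1)) ?_ ?_
    · exact ((Complex.measurable_ofReal.comp measurable_fract).aestronglyMeasurable).mul
        (hI _).aestronglyMeasurable
    · refine Eventually.of_forall fun t => ?_
      rw [norm_mul, Complex.norm_real, Real.norm_of_nonneg (Int.fract_nonneg t)]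
      have := (Int.fract_lt_one t).le
      have h2 : 0 ≤ ‖(t:ℂ) ^ (-s - 1)‖ := norm_nonneg _
      nlinarith
  have i1 : ∫ t in Ioc (1:ℝ) N, (t:ℂ) ^ (-s) = ((N:ℂ) ^ (1 - s) - 1) / (1 - s) := by
    rw [← intervalIntegral.integral_of_le hN', integral_cpow]
    · simp only [ofReal_natCast, ofReal_one, one_cpow]
      rw [show -s + 1 = 1 - s by ring]
    · right
      refine ⟨by intro h; apply h1; linear_combination -h, ?_⟩
      rw [uIcc_of_le hN']; simp
  have i2 : ∫ t in Ioc (1:ℝ) N, (t:ℂ) ^ (-s - 1) = ((N:ℂ) ^ (-s) - 1) / (-s) := by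
    rw [← intervalIntegral.integral_of_le hN', integral_cpow]
    · simp only [ofReal_natCast, ofReal_one, one_cpow]
      rw [show -s - 1 + 1 = -s by ring]
    · right
      refine ⟨by intro h; apply hs0; linear_combination -h, ?_⟩
      rw [uIcc_of_le hN']; simp
  have hA : IntegrableOn (fun t : ℝ => -s * (t:ℂ) ^ (-s) + -s * (t:ℂ) ^ (-s - 1)) (Ioc 1 (N:ℝ)) :=
    ((hI _).const_mul _).add ((hI _).const_mul _)
  rw [e2, integral_add hA (hfr.const_mul _),
    integral_add ((hI _).const_mul _) ((hI _).const_mul _),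
    integral_const_mul, integral_const_mul, integral_const_mul, i1, i2] at abel
  rw [← Finset.add_sum_Ioc_eq_sum_Icc hN]
  simp only [Nat.floor_one, Nat.floor_natCast, mul_one, ofReal_natCast, ofReal_one, one_cpow,
    Finset.sum_const, Nat.card_Icc, nsmul_eq_mul, Nat.cast_one, one_mul] at abel ⊢
  rw [abel]
  have hNc : (N:ℂ) ≠ 0 := by exact_mod_cast (by omega : N ≠ 0)
  have e4 : (N:ℂ) ^ (1 - s) = N * (N:ℂ) ^ (-s) := by
    rw [sub_eq_add_neg, cpow_add _ _ hNc, cpow_one]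
  have : (1 - s) ≠ 0 := by intro h; apply h1; linear_combination -h
  rw [e4]
  push_cast
  field_simp
  ring

/-- Truncated Dirichlet series representation of `ζ` in the half-plane `Re s > 0`. -/
lemma riemannZeta_eq_sum_add {s : ℂ} (hs : 0 < s.re) (h1 : s ≠ 1) {N : ℕ} (hN : 1 ≤ N) :
    riemannZeta s = ∑ n ∈ Finset.Icc 1 N, (n:ℂ) ^ (-s) + (N:ℂ) ^ (1 - s) / (s - 1)
      - s * ∫ t in Ioi (N:ℝ), ((Int.fract t : ℝ) : ℂ) * (t:ℂ) ^ (-s - 1) := by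
  have hs0 : s ≠ 0 := by rintro rfl; simp at hs
  have hN' : (1:ℝ) ≤ N := by exact_mod_cast hN
  rw [riemannZeta_eq_sub_integral_fract hs h1, mellin_fractTail_eq, sum_cpow_eq_sub_integral h1 hs0 hN,
    ← Ioc_union_Ioi_eq_Ioi hN', setIntegral_union (Set.Ioc_disjoint_Ioi le_rfl) measurableSet_Ioi]
  · ring
  · exact (integrableOn_rpow_mul_fract hs le_rfl).mono_set Ioc_subset_Ioi_self
  · exact integrableOn_rpow_mul_fract hs hN'

lemma norm_integral_fract_le {s : ℂ} (hs : 0 < s.re) {c : ℝ} (hc : 1 ≤ c) :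
    ‖∫ t in Ioi c, ((Int.fract t : ℝ) : ℂ) * (t:ℂ) ^ (-s - 1)‖ ≤ c ^ (-s.re) / s.re := by
  have h1 : IntegrableOn (fun t : ℝ => t ^ (-s.re - 1)) (Ioi c) :=
    integrableOn_Ioi_rpow_of_lt (by linarith) (by linarith)
  have h2 : ∫ t in Ioi c, t ^ (-s.re - 1) = c ^ (-s.re) / s.re := by
    rw [integral_Ioi_rpow_of_lt (by linarith) (by linarith), sub_add_cancel, neg_div_neg_eq]
  rw [← h2]
  refine norm_integral_le_of_norm_le h1 ?_
  filter_upwards [ae_restrict_mem measurableSet_Ioi] with t ht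
  have h0 : (0:ℝ) < t := by have := Set.mem_Ioi.1 ht; linarith
  rw [norm_mul, Complex.norm_real, norm_cpow_eq_rpow_re_of_pos h0,
    Real.norm_of_nonneg (Int.fract_nonneg t)]
  simp only [sub_re, neg_re, one_re]
  have := (Int.fract_lt_one t).le
  have h2 : 0 ≤ t ^ (-s.re - 1) := by positivity
  nlinarith

lemma sum_rpow_neg_le {ε σ : ℝ} (hε : 0 < ε) (hσ : 1 - ε ≤ σ) {N : ℕ} (hN : 1 ≤ N) :
    ∑ n ∈ Finset.Icc 1 N, (n:ℝ) ^ (-σ) ≤ (1 + 1 / ε) * (N:ℝ) ^ (2 * ε) := by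
  have hN' : (1:ℝ) ≤ N := by exact_mod_cast hN
  have h1 : ∑ n ∈ Finset.Icc 1 N, (n:ℝ) ^ (-σ) ≤ ∑ n ∈ Finset.Icc 1 N, (N:ℝ) ^ ε * (n:ℝ)⁻¹ := by
    refine Finset.sum_le_sum fun n hn => ?_
    rw [Finset.mem_Icc] at hn
    have hn1 : (1:ℝ) ≤ n := by exact_mod_cast hn.1
    have hn2 : (n:ℝ) ≤ N := by exact_mod_cast hn.2
    calc (n:ℝ) ^ (-σ) ≤ (n:ℝ) ^ (ε + (-1)) := Real.rpow_le_rpow_of_exponent_le hn1 (by linarith)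
      _ = (n:ℝ) ^ ε * (n:ℝ)⁻¹ := by rw [Real.rpow_add (by linarith), Real.rpow_neg_one]
      _ ≤ _ := by gcongr
  have h2 : ∑ n ∈ Finset.Icc 1 N, (n:ℝ)⁻¹ ≤ 1 + Real.log N := by
    have := harmonic_le_one_add_log N
    rw [harmonic_eq_sum_Icc] at this
    push_cast at this
    exact this
  have h3 := Real.log_le_rpow_div (x := (N:ℝ)) (by linarith) hε
  have h4 : (1:ℝ) ≤ (N:ℝ) ^ ε := Real.one_le_rpow hN' hε.le
  rw [← Finset.mul_sum] at h1
  calc _ ≤ _ := h1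
    _ ≤ (N:ℝ) ^ ε * ((N:ℝ) ^ ε + (N:ℝ) ^ ε / ε) := by gcongr; linarith
    _ = (1 + 1 / ε) * ((N:ℝ) ^ ε * (N:ℝ) ^ ε) := by field_simp
    _ = _ := by rw [← Real.rpow_add (by linarith)]; ring_nf

/-- Polynomial bound for `ζ` slightly to the left of `Re s = 1`. -/
lemma norm_riemannZeta_le {ε : ℝ} (hε : 0 < ε) (hε' : ε ≤ 1 / 2) :
    ∃ C > 0, ∀ s : ℂ, 1 - ε ≤ s.re → s.re ≤ 3 → 1 ≤ |s.im| → ‖riemannZeta s‖ ≤ C * |s.im| ^ (2 * ε) := by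
  refine ⟨(10 + 1 / ε) * 2 ^ (2 * ε), by positivity, fun s h1 h3 ht => ?_⟩
  set N := ⌈|s.im|⌉₊ with hNdef
  have hN : 1 ≤ N := Nat.one_le_ceil_iff.2 (by linarith)
  have hN' : (1:ℝ) ≤ N := by exact_mod_cast hN
  have hNl : |s.im| ≤ N := Nat.le_ceil _
  have hNu : (N:ℝ) ≤ 2 * |s.im| := by
    have := Nat.ceil_lt_add_one (abs_nonneg s.im)
    linarith
  have hre : 0 < s.re := by linarith
  have hs1 : s ≠ 1 := by rintro rfl; norm_num at ht
  have hsn : ‖s‖ ≤ 4 * N := by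
    have := norm_le_abs_re_add_abs_im s
    rw [abs_of_pos hre] at this
    linarith
  have hs1n : 1 ≤ ‖s - 1‖ := by
    have := abs_im_le_norm (s - 1)
    simp at this
    linarith
  have b1 : ‖∑ n ∈ Finset.Icc 1 N, (n:ℂ) ^ (-s)‖ ≤ (1 + 1 / ε) * (N:ℝ) ^ (2 * ε) := by
    refine (norm_sum_le _ _).trans (le_trans (le_of_eq ?_) (sum_rpow_neg_le hε h1 hN))
    refine Finset.sum_congr rfl fun n hn => ?_
    rw [Finset.mem_Icc] at hn
    rw [norm_natCast_cpow_of_pos (by omega)]; simp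
  have p1 : (N:ℝ) ^ ε ≤ (N:ℝ) ^ (2 * ε) := Real.rpow_le_rpow_of_exponent_le hN' (by linarith)
  have b2 : ‖(N:ℂ) ^ (1 - s) / (s - 1)‖ ≤ (N:ℝ) ^ (2 * ε) := by
    rw [norm_div, norm_natCast_cpow_of_pos (by omega)]
    refine (div_le_self (by positivity) hs1n).trans ?_
    refine le_trans (Real.rpow_le_rpow_of_exponent_le hN' ?_) p1
    simp; linarith
  have b3 : ‖s * ∫ t in Ioi (N:ℝ), ((Int.fract t : ℝ) : ℂ) * (t:ℂ) ^ (-s - 1)‖ ≤ 8 * (N:ℝ) ^ (2 * ε) := by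
    rw [norm_mul]
    have q1 := norm_integral_fract_le hre hN'
    have q2 : (N:ℝ) ^ (-s.re) / s.re ≤ 2 * (N:ℝ) ^ (ε + (-1)) := by
      rw [div_le_iff₀ hre]
      have : (N:ℝ) ^ (-s.re) ≤ (N:ℝ) ^ (ε + (-1)) :=
        Real.rpow_le_rpow_of_exponent_le hN' (by linarith)
      have h0 : 0 ≤ (N:ℝ) ^ (ε + (-1)) := by positivity
      nlinarith
    calc _ ≤ (4 * (N:ℝ)) * (2 * (N:ℝ) ^ (ε + (-1))) := by
          gcongr; exact q1.trans q2
      _ = 8 * (N:ℝ) ^ ε := by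
          rw [Real.rpow_add (by linarith), Real.rpow_neg_one]; field_simp; ring
      _ ≤ _ := by gcongr
  rw [riemannZeta_eq_sum_add hre hs1 hN]
  have h4 : (N:ℝ) ^ (2 * ε) ≤ 2 ^ (2 * ε) * |s.im| ^ (2 * ε) := by
    rw [← Real.mul_rpow (by norm_num) (abs_nonneg _)]
    exact Real.rpow_le_rpow (by linarith) hNu (by linarith)
  calc _ ≤ _ := (norm_sub_le _ _).trans (add_le_add (norm_add_le _ _) le_rfl)
    _ ≤ (10 + 1 / ε) * (N:ℝ) ^ (2 * ε) := by linarith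
    _ ≤ (10 + 1 / ε) * (2 ^ (2 * ε) * |s.im| ^ (2 * ε)) := by gcongr
    _ = _ := by ring

lemma one_le_abs_rpow {t : ℝ} (ht : 1 ≤ |t|) : 1 ≤ |t| ^ (1 / 50 : ℝ) :=
  Real.one_le_rpow ht (by norm_num)

lemma abs_rpow_le_two_mul {t u : ℝ} (h : |u| ≤ 2 * |t|) :
    |u| ^ (1 / 50 : ℝ) ≤ 2 * |t| ^ (1 / 50 : ℝ) := by
  calc |u| ^ (1 / 50 : ℝ) ≤ (2 * |t|) ^ (1 / 50 : ℝ) := by gcongr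
    _ = 2 ^ (1 / 50 : ℝ) * |t| ^ (1 / 50 : ℝ) := Real.mul_rpow (by norm_num) (abs_nonneg _)
    _ ≤ 2 ^ (1 : ℝ) * |t| ^ (1 / 50 : ℝ) := by gcongr <;> norm_num
    _ = _ := by rw [Real.rpow_one]

lemma norm_riemannZeta_le_rpow :
    ∃ C > 0, ∀ s : ℂ, 99 / 100 ≤ s.re → s.re ≤ 3 → 1 ≤ |s.im| →
      ‖riemannZeta s‖ ≤ C * |s.im| ^ (1 / 50 : ℝ) := by
  obtain ⟨C, hC, h⟩ := norm_riemannZeta_le (ε := 1 / 100) (by norm_num) (by norm_num)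
  refine ⟨C, hC, fun s h1 h2 h3 => ?_⟩
  have := h s (by linarith) h2 h3
  norm_num at this ⊢
  exact this

lemma norm_deriv_riemannZeta_le_rpow :
    ∃ C > 0, ∀ s : ℂ, 199 / 200 ≤ s.re → s.re ≤ 5 / 2 → 2 ≤ |s.im| →
      ‖deriv riemannZeta s‖ ≤ C * |s.im| ^ (1 / 50 : ℝ) := by
  obtain ⟨C, hC, h⟩ := norm_riemannZeta_le_rpow
  refine ⟨400 * C, by positivity, fun s h1 h2 h3 => ?_⟩
  have key : ∀ w : ℂ, ‖w - s‖ ≤ 1 / 200 → 99 / 100 ≤ w.re ∧ w.re ≤ 3 ∧ 1 ≤ |w.im| ∧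
      |w.im| ≤ 2 * |s.im| := by
    intro w hw
    have a1 := (abs_re_le_norm (w - s)).trans hw
    have a2 := (abs_im_le_norm (w - s)).trans hw
    rw [sub_re, abs_le] at a1
    rw [sub_im] at a2
    have a3 := abs_sub_abs_le_abs_sub w.im s.im
    have a4 := abs_sub_abs_le_abs_sub s.im w.im
    rw [abs_sub_comm] at a4
    exact ⟨by linarith, by linarith, by linarith, by linarith⟩
  have := norm_deriv_le_of_forall_mem_sphere_norm_le (c := s) (R := 1 / 200) (f := riemannZeta)
    (C := C * (2 * |s.im| ^ (1 / 50 : ℝ))) (by norm_num) ?_ ?_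
  · calc _ ≤ _ := this
      _ = _ := by ring
  · refine DifferentiableOn.diffContOnCl_ball (U := Metric.closedBall s (1 / 200)) ?_ subset_rfl
    intro w hw
    rw [Metric.mem_closedBall, dist_eq] at hw
    have := key w hw
    refine (differentiableAt_riemannZeta ?_).differentiableWithinAt
    rintro rfl
    norm_num at this
  · intro w hw
    rw [Metric.mem_sphere, dist_eq] at hw
    obtain ⟨k1, k2, k3, k4⟩ := key w hw.le
    exact (h w k1 k2 k3).trans (by gcongr; exact abs_rpow_le_two_mul k4)

lemma norm_riemannZeta_ofReal_le : ∃ C > 0, ∀ σ : ℝ, 1 < σ → σ ≤ 2 →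
    ‖riemannZeta σ‖ ≤ C / (σ - 1) := by
  have hc : ContinuousOn (fun σ : ℝ => ‖riemannZeta₁ σ‖) (Icc 1 2) :=
    (differentiable_riemannZeta₁.continuous.comp continuous_ofReal).norm.continuousOn
  obtain ⟨C, hC⟩ := (isCompact_Icc.image_of_continuousOn hc).bddAbove
  refine ⟨max C 1, by positivity, fun σ h1 h2 => ?_⟩
  have hne : (σ:ℂ) ≠ 1 := by exact_mod_cast h1.ne'
  rw [riemannZeta_eq_inv_sub_mul hne, norm_mul, norm_inv, ← ofReal_one, ← ofReal_sub, norm_real,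
    Real.norm_of_nonneg (by linarith), div_eq_inv_mul]
  gcongr
  exact le_max_of_le_left (hC ⟨σ, ⟨h1.le, h2⟩, rfl⟩)

lemma pow_four_norm_riemannZeta_ge : ∃ c > 0, ∀ s : ℂ, 1 < s.re → s.re ≤ 2 → 1 ≤ |s.im| →
    c * (s.re - 1) ^ 3 ≤ ‖riemannZeta s‖ ^ 4 * |s.im| ^ (1 / 50 : ℝ) := by
  obtain ⟨C, hC, h⟩ := norm_riemannZeta_le_rpow
  obtain ⟨D, hD, h'⟩ := norm_riemannZeta_ofReal_le
  refine ⟨(D ^ 3 * (C * 2))⁻¹, by positivity, fun s h1 h2 h3 => ?_⟩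
  have := DirichletCharacter.norm_LFunction_product_ge_one (N := 1) (1 : DirichletCharacter ℂ 1)
    (x := s.re - 1) (by linarith) s.im
  have e1 : (1:ℂ) + ((s.re - 1 : ℝ) : ℂ) = ((s.re : ℝ) : ℂ) := by push_cast; ring
  have e2 : (1:ℂ) + ((s.re - 1 : ℝ) : ℂ) + I * s.im = s := by
    rw [e1, mul_comm I, re_add_im]
  rw [DirichletCharacter.LFunctionTrivChar, DirichletCharacter.LFunction_modOne_eq,
    DirichletCharacter.LFunction_modOne_eq, e2, e1, norm_mul, norm_mul, norm_pow, norm_pow] at this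
  have b1 := h' s.re h1 h2
  have b2 := h ((s.re:ℂ) + 2 * I * s.im) (by simp; linarith) (by simp; linarith)
    (by simp [abs_mul]; linarith)
  have e3 : ((s.re:ℂ) + 2 * I * s.im).im = 2 * s.im := by simp
  rw [e3] at b2
  have b3 : |2 * s.im| ^ (1 / 50 : ℝ) ≤ 2 * |s.im| ^ (1 / 50 : ℝ) :=
    abs_rpow_le_two_mul (by rw [abs_mul]; norm_num)
  set z := ‖riemannZeta s‖
  set U := |s.im| ^ (1 / 50 : ℝ)
  have hx : 0 < s.re - 1 := by linarith
  have : 1 ≤ (D / (s.re - 1)) ^ 3 * z ^ 4 * (C * (2 * U)) := by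
    refine this.le.trans ?_
    gcongr
    exact b2.trans (by gcongr)
  rw [inv_mul_le_iff₀ (by positivity)]
  rw [div_pow] at this
  have h5 : (s.re - 1) ^ 3 * 1 ≤ (s.re - 1) ^ 3 * (D ^ 3 / (s.re - 1) ^ 3 * z ^ 4 * (C * (2 * U))) := by
    gcongr
  have h6 : (s.re - 1) ^ 3 * (D ^ 3 / (s.re - 1) ^ 3 * z ^ 4 * (C * (2 * U))) =
    D ^ 3 * (C * 2) * (z ^ 4 * U) := by field_simp
  linarith

lemma norm_riemannZeta_sub_le {C : ℝ} (hC : ∀ s : ℂ, 199 / 200 ≤ s.re → s.re ≤ 5 / 2 → 2 ≤ |s.im| →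
      ‖deriv riemannZeta s‖ ≤ C * |s.im| ^ (1 / 50 : ℝ)) (hC0 : 0 < C) {s w : ℂ} (hs1 : 1 ≤ s.re)
      (hs2 : s.re ≤ 2) (hs3 : 3 ≤ |s.im|) {r : ℝ} (hr : r ≤ 1 / 200) (hw : ‖w - s‖ ≤ r) :
    ‖riemannZeta w - riemannZeta s‖ ≤ C * (2 * |s.im| ^ (1 / 50 : ℝ)) * r := by
  have key : ∀ w : ℂ, ‖w - s‖ ≤ 1 / 200 → 199 / 200 ≤ w.re ∧ w.re ≤ 5 / 2 ∧ 2 ≤ |w.im| ∧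
      |w.im| ≤ 2 * |s.im| := by
    intro w hw
    have a1 := (abs_re_le_norm (w - s)).trans hw
    have a2 := (abs_im_le_norm (w - s)).trans hw
    rw [sub_re, abs_le] at a1
    rw [sub_im] at a2
    have a3 := abs_sub_abs_le_abs_sub w.im s.im
    have a4 := abs_sub_abs_le_abs_sub s.im w.im
    rw [abs_sub_comm] at a4
    exact ⟨by linarith, by linarith, by linarith, by linarith⟩
  have := (convex_closedBall s r).norm_image_sub_le_of_norm_deriv_le (f := riemannZeta)
    (C := C * (2 * |s.im| ^ (1 / 50 : ℝ))) (x := s) (y := w) ?_ ?_ ?_ ?_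
  · exact this.trans (by gcongr)
  · intro v hv
    rw [Metric.mem_closedBall, dist_eq] at hv
    have := key v (hv.trans hr)
    refine differentiableAt_riemannZeta ?_
    rintro rfl
    norm_num at this
  · intro v hv
    rw [Metric.mem_closedBall, dist_eq] at hv
    obtain ⟨k1, k2, k3, k4⟩ := key v (hv.trans hr)
    exact (hC v k1 k2 k3).trans (by gcongr; exact abs_rpow_le_two_mul k4)
  · simpa using (norm_nonneg _).trans hw
  · simpa [dist_eq] using hw

lemma norm_riemannZeta_ge : ∃ c > 0, ∀ s : ℂ, 1 ≤ s.re → s.re ≤ 2 → 3 ≤ |s.im| →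
    c ≤ ‖riemannZeta s‖ * (|s.im| ^ (1 / 50 : ℝ)) ^ 4 := by
  obtain ⟨C, hC, h⟩ := norm_deriv_riemannZeta_le_rpow
  obtain ⟨c, hc, h'⟩ := pow_four_norm_riemannZeta_ge
  obtain ⟨k, hk, hkc⟩ : ∃ k > 0, k ^ 4 = c := by
    refine ⟨c ^ (1 / 4 : ℝ), by positivity, ?_⟩
    rw [← Real.rpow_natCast, ← Real.rpow_mul hc.le]; norm_num
  obtain ⟨b, hb, hb1, hb2⟩ : ∃ b > 0, b ≤ 1 / 200 ∧ b * (C * 2) ≤ k / 2 := by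
    refine ⟨min (1 / 200) (k / 2 / (C * 2)), by positivity, min_le_left _ _, ?_⟩
    rw [← le_div_iff₀ (by positivity)]
    exact min_le_right _ _
  have far : ∀ s : ℂ, s.re ≤ 2 → 3 ≤ |s.im| →
      b ^ 4 ≤ (s.re - 1) * (|s.im| ^ (1 / 50 : ℝ)) ^ 5 →
      k * b ^ 3 ≤ ‖riemannZeta s‖ * (|s.im| ^ (1 / 50 : ℝ)) ^ 4 := by
    intro s h2 h3 h4
    set U := |s.im| ^ (1 / 50 : ℝ) with hU
    have hU1 : 1 ≤ U := one_le_abs_rpow (by linarith)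
    have h1 : 1 < s.re := by
      by_contra! hcon
      have : (s.re - 1) * U ^ 5 ≤ 0 := mul_nonpos_of_nonpos_of_nonneg (by linarith) (by positivity)
      have : 0 < b ^ 4 := by positivity
      linarith
    have := h' s h1 h2 (by linarith)
    rw [← hkc] at this
    refine le_of_pow_le_pow_left₀ (n := 4) (by norm_num) (by positivity) ?_
    calc (k * b ^ 3) ^ 4 = k ^ 4 * (b ^ 4) ^ 3 := by ring
      _ ≤ k ^ 4 * ((s.re - 1) * U ^ 5) ^ 3 := by gcongr
      _ = (k ^ 4 * (s.re - 1) ^ 3) * U ^ 15 := by ring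
      _ ≤ (‖riemannZeta s‖ ^ 4 * U) * U ^ 15 := by gcongr
      _ = _ := by ring
  refine ⟨k * b ^ 3 / 2, by positivity, fun s h1 h2 h3 => ?_⟩
  set U := |s.im| ^ (1 / 50 : ℝ) with hU
  have hU1 : 1 ≤ U := one_le_abs_rpow (by linarith)
  by_cases hfar : b ^ 4 ≤ (s.re - 1) * U ^ 5
  · have := far s h2 h3 hfar
    have : 0 < k * b ^ 3 := by positivity
    linarith
  · push Not at hfar
    have hr : b ^ 4 / U ^ 5 ≤ 1 / 200 := by
      rw [div_le_iff₀ (by positivity)]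
      have : b ^ 4 ≤ b * 1 ^ 3 := by rw [pow_succ']; gcongr; linarith
      have : 1 ≤ U ^ 5 := one_le_pow₀ hU1
      linarith
    set s' : ℂ := ⟨1 + b ^ 4 / U ^ 5, s.im⟩ with hs'
    have hs're : s'.re = 1 + b ^ 4 / U ^ 5 := rfl
    have hs'im : s'.im = s.im := rfl
    have hdiff : s.re - 1 < b ^ 4 / U ^ 5 := by rwa [lt_div_iff₀ (by positivity)]
    have hnorm : ‖s' - s‖ ≤ b ^ 4 / U ^ 5 := by
      refine (norm_le_abs_re_add_abs_im _).trans ?_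
      rw [sub_re, sub_im, hs're, hs'im, sub_self, abs_zero, add_zero, abs_of_nonneg (by linarith)]
      linarith
    have h4 := norm_riemannZeta_sub_le h hC h1 h2 h3 hr hnorm
    have h5 := far s' (by rw [hs're]; linarith) (by rwa [hs'im]) (by
      rw [hs're, hs'im, ← hU]; apply le_of_eq; field_simp; ring)
    rw [hs'im, ← hU] at h5
    have h6 : ‖riemannZeta s'‖ ≤ ‖riemannZeta s‖ + C * (2 * U) * (b ^ 4 / U ^ 5) := by
      have := norm_sub_norm_le (riemannZeta s') (riemannZeta s)
      linarith
    have h7 : k * b ^ 3 ≤ ‖riemannZeta s‖ * U ^ 4 + C * (2 * U) * (b ^ 4 / U ^ 5) * U ^ 4 := by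
      calc _ ≤ _ := h5
        _ ≤ (‖riemannZeta s‖ + C * (2 * U) * (b ^ 4 / U ^ 5)) * U ^ 4 := by gcongr
        _ = _ := by ring
    have h8 : C * (2 * U) * (b ^ 4 / U ^ 5) * U ^ 4 = (b * (C * 2)) * b ^ 3 := by
      field_simp
    have h9 : (b * (C * 2)) * b ^ 3 ≤ k / 2 * b ^ 3 := by gcongr
    linarith

/-- The Laplace transform of `ψ(x) - x`, continued past `Re s = 1`. -/
noncomputable def psiTransform (s : ℂ) : ℂ := -s⁻¹ - deriv riemannZeta₁ s / (s * riemannZeta₁ s)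

lemma riemannZeta₁_eq {s : ℂ} (hs : s ≠ 1) : riemannZeta₁ s = (s - 1) * riemannZeta s := by
  rw [riemannZeta_eq_inv_sub_mul hs, mul_inv_cancel_left₀ (sub_ne_zero.2 hs)]

lemma psiTransform_eq {s : ℂ} (h0 : s ≠ 0) (h1 : s ≠ 1) (hz : riemannZeta s ≠ 0) :
    psiTransform s = -(deriv riemannZeta s / (s * riemannZeta s)) - (s - 1)⁻¹ := by
  have h1' := sub_ne_zero.2 h1
  have e1 := riemannZeta₁_eq h1
  have e2 : deriv riemannZeta₁ s = riemannZeta s + (s - 1) * deriv riemannZeta s := by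
    have hev : riemannZeta₁ =ᶠ[𝓝 s] fun w => (w - 1) * riemannZeta w := by
      filter_upwards [isOpen_ne.mem_nhds h1] with w hw using riemannZeta₁_eq hw
    rw [hev.deriv_eq]
    have := ((hasDerivAt_id s).sub_const 1).mul (differentiableAt_riemannZeta h1).hasDerivAt
    rw [HasDerivAt.deriv (f := fun w => (w - 1) * riemannZeta w) this]
    simp
  rw [psiTransform, e1, e2]
  field_simp
  ring

lemma analyticAt_psiTransform {s : ℂ} (hs : s ≠ 0) (hz : riemannZeta₁ s ≠ 0) :
    AnalyticAt ℂ psiTransform s := by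
  have h1 : AnalyticAt ℂ riemannZeta₁ s := differentiable_riemannZeta₁.analyticAt s
  have h2 : AnalyticAt ℂ (fun s : ℂ => s) s := analyticAt_id
  exact ((h2.inv hs).neg).sub (h1.deriv.div (h2.mul h1) (mul_ne_zero hs hz))

lemma riemannZeta₁_ne_zero {s : ℂ} (hs : 1 ≤ s.re) : riemannZeta₁ s ≠ 0 := by
  rcases eq_or_ne s 1 with rfl | h1
  · rw [riemannZeta₁_one]; exact one_ne_zero
  · rw [riemannZeta₁_eq h1]
    exact mul_ne_zero (sub_ne_zero.2 h1) (riemannZeta_ne_zero_of_one_le_re hs)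

lemma analyticAt_psiTransform_of_one_le {s : ℂ} (hs : 1 ≤ s.re) : AnalyticAt ℂ psiTransform s :=
  analyticAt_psiTransform (by rintro rfl; norm_num at hs) (riemannZeta₁_ne_zero hs)

lemma norm_iteratedDeriv_psiTransform_le_of_three_le : ∃ C > 0, ∀ s : ℂ, 1 ≤ s.re → s.re ≤ 2 →
    3 ≤ |s.im| → ‖iteratedDeriv 2 psiTransform s‖ ≤ C * |s.im| ^ (-(7 / 10) : ℝ) := by
  obtain ⟨C, hC, h⟩ := norm_deriv_riemannZeta_le_rpow
  obtain ⟨c, hc, h'⟩ := norm_riemannZeta_ge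
  obtain ⟨b, hb, hb1, hb2⟩ : ∃ b > 0, b ≤ 1 / 200 ∧ b * (C * 2) ≤ c / 2 := by
    refine ⟨min (1 / 200) (c / 2 / (C * 2)), by positivity, min_le_left _ _, ?_⟩
    rw [← le_div_iff₀ (by positivity)]
    exact min_le_right _ _
  refine ⟨2 * (C * 2 * 2 * (2 / c) + 2) / b ^ 2, by positivity, fun s h1 h2 h3 => ?_⟩
  set U := |s.im| ^ (1 / 50 : ℝ) with hU
  have ht : 0 < |s.im| := by linarith
  have hU1 : 1 ≤ U := one_le_abs_rpow (by linarith)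
  set r := b / U ^ 5 with hr
  have hr0 : 0 < r := by positivity
  have hr1 : r ≤ 1 / 200 := by
    rw [hr]
    exact (div_le_self hb.le (one_le_pow₀ hU1)).trans hb1
  have key : ∀ w : ℂ, ‖w - s‖ ≤ r → 199 / 200 ≤ w.re ∧ w.re ≤ 5 / 2 ∧ 2 ≤ |w.im| ∧
      |w.im| ≤ 2 * |s.im| ∧ |s.im| / 2 ≤ |w.im| ∧ c / 2 ≤ ‖riemannZeta w‖ * U ^ 4 := by
    intro w hw
    have a1 := (abs_re_le_norm (w - s)).trans hw
    have a2 := (abs_im_le_norm (w - s)).trans hw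
    rw [sub_re, abs_le] at a1
    rw [sub_im] at a2
    have a3 := abs_sub_abs_le_abs_sub w.im s.im
    have a4 := abs_sub_abs_le_abs_sub s.im w.im
    rw [abs_sub_comm] at a4
    refine ⟨by linarith, by linarith, by linarith, by linarith, by linarith, ?_⟩
    have b1 := norm_riemannZeta_sub_le h hC h1 h2 h3 hr1 hw
    have b2 := h' s h1 h2 h3
    rw [← hU] at b1 b2
    have h6 : ‖riemannZeta s‖ ≤ ‖riemannZeta w‖ + C * (2 * U) * r := by
      have := norm_sub_norm_le (riemannZeta s) (riemannZeta w)
      rw [norm_sub_rev] at this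
      linarith
    have h7 : c ≤ ‖riemannZeta w‖ * U ^ 4 + C * (2 * U) * r * U ^ 4 := by
      calc _ ≤ _ := b2
        _ ≤ (‖riemannZeta w‖ + C * (2 * U) * r) * U ^ 4 := by gcongr
        _ = _ := by ring
    have h8 : C * (2 * U) * r * U ^ 4 = b * (C * 2) := by
      rw [hr]; field_simp
    linarith
  have bound : ∀ w : ℂ, ‖w - s‖ ≤ r → AnalyticAt ℂ psiTransform w ∧
      ‖psiTransform w‖ ≤ (C * 2 * 2 * (2 / c) + 2) * U ^ 5 / |s.im| := by
    intro w hw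
    obtain ⟨k1, k2, k3, k4, k5, k6⟩ := key w hw
    have hz0 : 0 < ‖riemannZeta w‖ := by
      by_contra! hcon
      have : ‖riemannZeta w‖ * U ^ 4 ≤ 0 := mul_nonpos_of_nonpos_of_nonneg hcon (by positivity)
      linarith
    have hz : riemannZeta w ≠ 0 := norm_pos_iff.1 hz0
    have w0 : w ≠ 0 := by rintro rfl; norm_num at k3
    have w1 : w ≠ 1 := by rintro rfl; norm_num at k3
    have n0 : |s.im| / 2 ≤ ‖w‖ := k5.trans (abs_im_le_norm w)
    have n1 : |s.im| / 2 ≤ ‖w - 1‖ := by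
      have := abs_im_le_norm (w - 1)
      simp only [sub_im, one_im, sub_zero] at this
      linarith
    refine ⟨analyticAt_psiTransform w0 ?_, ?_⟩
    · rw [riemannZeta₁_eq w1]
      exact mul_ne_zero (sub_ne_zero.2 w1) hz
    · rw [psiTransform_eq w0 w1 hz]
      refine (norm_sub_le _ _).trans ?_
      rw [norm_neg, norm_div, norm_mul, norm_inv]
      have d1 : ‖deriv riemannZeta w‖ ≤ C * (2 * U) :=
        (h w k1 k2 k3).trans (by gcongr; exact abs_rpow_le_two_mul k4)
      have hz' : c / 2 / U ^ 4 ≤ ‖riemannZeta w‖ := by rwa [div_le_iff₀ (by positivity)]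
      have e1 : ‖deriv riemannZeta w‖ / (‖w‖ * ‖riemannZeta w‖) ≤
          C * (2 * U) / (|s.im| / 2 * (c / 2 / U ^ 4)) := by gcongr
      have e2 : ‖w - 1‖⁻¹ ≤ 2 * U ^ 5 / |s.im| := by
        rw [inv_le_comm₀ (norm_pos_iff.2 (sub_ne_zero.2 w1)) (by positivity), inv_div]
        refine le_trans ?_ n1
        have : 1 ≤ U ^ 5 := one_le_pow₀ hU1
        gcongr; linarith
      calc _ ≤ _ := add_le_add e1 e2
        _ = _ := by field_simp
  have := norm_iteratedDeriv_le_of_forall_mem_sphere_norm_le (c := s) (R := r)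
    (f := psiTransform) (C := (C * 2 * 2 * (2 / c) + 2) * U ^ 5 / |s.im|) 2 hr0 ?_ ?_
  · refine this.trans (le_of_eq ?_)
    have : |s.im| ^ (-(7 / 10) : ℝ) = U ^ 15 / |s.im| := by
      rw [hU, ← Real.rpow_natCast, ← Real.rpow_mul ht.le, ← Real.rpow_sub_one ht.ne']
      norm_num
    rw [this, hr]
    simp only [Nat.factorial]
    push_cast
    field_simp
  · refine DifferentiableOn.diffContOnCl_ball (U := Metric.closedBall s r) ?_ subset_rfl
    intro w hw
    rw [Metric.mem_closedBall, dist_eq] at hw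
    exact (bound w hw).1.differentiableAt.differentiableWithinAt
  · intro w hw
    rw [Metric.mem_sphere, dist_eq] at hw
    exact (bound w hw.le).2

/-- The second derivative of `psiTransform` is uniformly square integrable on vertical lines. -/
lemma norm_iteratedDeriv_psiTransform_le : ∃ C > 0, ∀ s : ℂ, 1 ≤ s.re → s.re ≤ 2 →
    ‖iteratedDeriv 2 psiTransform s‖ ≤ C * (1 + |s.im|) ^ (-(7 / 10) : ℝ) := by
  obtain ⟨C, hC, h⟩ := norm_iteratedDeriv_psiTransform_le_of_three_le
  have hc : ContinuousOn (fun s : ℂ => ‖iteratedDeriv 2 psiTransform s‖)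
      (Icc 1 2 ×ℂ Icc (-3) 3) := by
    intro s hs
    have : AnalyticAt ℂ (iteratedDeriv 2 psiTransform) s := by
      rw [iteratedDeriv_eq_iterate]
      exact (analyticAt_psiTransform_of_one_le (Complex.mem_reProdIm.1 hs).1.1).iterated_deriv 2
    exact this.continuousAt.norm.continuousWithinAt
  obtain ⟨D, hD⟩ := ((isCompact_Icc.reProdIm isCompact_Icc).image_of_continuousOn hc).bddAbove
  refine ⟨max (C * 2) (max D 1 * 4), by positivity, fun s h1 h2 => ?_⟩
  rcases le_total 3 |s.im| with h3 | h3
  · refine (h s h1 h2 h3).trans ?_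
    have ht : 0 < |s.im| := by linarith
    have : |s.im| ^ (-(7 / 10) : ℝ) ≤ 2 * (1 + |s.im|) ^ (-(7 / 10) : ℝ) := by
      calc |s.im| ^ (-(7 / 10) : ℝ) = 2 ^ (7 / 10 : ℝ) * (2 * |s.im|) ^ (-(7 / 10) : ℝ) := by
            rw [Real.mul_rpow (by norm_num) ht.le, ← mul_assoc, ← Real.rpow_add (by norm_num)]
            norm_num
        _ ≤ 2 ^ (1:ℝ) * (1 + |s.im|) ^ (-(7 / 10) : ℝ) := by
            gcongr ?_ * ?_
            · exact Real.rpow_le_rpow_of_exponent_le (by norm_num) (by norm_num)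
            · exact Real.rpow_le_rpow_of_nonpos (by linarith) (by linarith) (by norm_num)
        _ = _ := by rw [Real.rpow_one]
    calc _ ≤ C * (2 * (1 + |s.im|) ^ (-(7 / 10) : ℝ)) := by gcongr
      _ = (C * 2) * (1 + |s.im|) ^ (-(7 / 10) : ℝ) := by ring
      _ ≤ _ := by gcongr; exact le_max_left _ _
  · have b1 : ‖iteratedDeriv 2 psiTransform s‖ ≤ max D 1 :=
      (hD ⟨s, Complex.mem_reProdIm.2 ⟨⟨h1, h2⟩, abs_le.1 h3⟩, rfl⟩).trans (le_max_left _ _)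
    have : (1 / 4 : ℝ) ≤ (1 + |s.im|) ^ (-(7 / 10) : ℝ) := by
      have h0 := abs_nonneg s.im
      calc (1 / 4 : ℝ) = 4 ^ (-1 : ℝ) := by rw [Real.rpow_neg_one]; norm_num
        _ ≤ 4 ^ (-(7 / 10) : ℝ) := Real.rpow_le_rpow_of_exponent_le (by norm_num) (by norm_num)
        _ ≤ _ := Real.rpow_le_rpow_of_nonpos (by linarith) (by linarith) (by norm_num)
    calc _ ≤ max D 1 * 4 * (1 / 4) := by linarith
      _ ≤ _ := by gcongr; exact le_max_right _ _

/-- The error term `ψ(x) - x`, restricted to `x > 1`. -/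
noncomputable def psiErr (x : ℝ) : ℂ :=
  (Ioi (1:ℝ)).indicator (fun x => ((Chebyshev.psi x - x : ℝ) : ℂ)) x

lemma measurable_psiErr : Measurable psiErr :=
  (Complex.measurable_ofReal.comp (Chebyshev.psi_mono.measurable.sub measurable_id)).indicator
    measurableSet_Ioi

lemma psiErr_of_le {x : ℝ} (hx : x ≤ 1) : psiErr x = 0 :=
  indicator_of_notMem (by simpa using hx) _

lemma psiErr_of_gt {x : ℝ} (hx : 1 < x) : psiErr x = ((Chebyshev.psi x - x : ℝ) : ℂ) :=
  indicator_of_mem (by simpa using hx) _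

lemma norm_psiErr_le (x : ℝ) (hx : 0 ≤ x) : ‖psiErr x‖ ≤ 7 * x := by
  have h4 : Real.log 4 ≤ 2 := by
    rw [show (4:ℝ) = 2 ^ 2 by norm_num, Real.log_pow]
    have := Real.log_two_lt_d9
    push_cast; linarith
  rcases le_or_gt x 1 with h | h
  · rw [psiErr_of_le h]; simpa using hx
  · rw [psiErr_of_gt h, norm_real, Real.norm_eq_abs, abs_le]
    have h1 := Chebyshev.psi_le_const_mul_self hx
    have h2 := Chebyshev.psi_nonneg x
    constructor <;> nlinarith

lemma sum_vonMangoldt_isBigO :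
    (fun n : ℕ ↦ ∑ k ∈ Finset.Icc 1 n, ArithmeticFunction.vonMangoldt k) =O[atTop]
      fun n ↦ (n : ℝ) ^ (1:ℝ) := by
  refine Asymptotics.IsBigO.of_bound (Real.log 4 + 4) (Eventually.of_forall fun n => ?_)
  have h1 := Chebyshev.psi_le_const_mul_self (x := n) (by positivity)
  have h2 := Chebyshev.psi_nonneg n
  have h3 : Chebyshev.psi n = ∑ k ∈ Finset.Icc 1 n, ArithmeticFunction.vonMangoldt k := by
    rw [Chebyshev.psi, Nat.floor_natCast]; rfl
  rw [← h3, Real.norm_of_nonneg h2, Real.rpow_one, Real.norm_of_nonneg (by positivity)]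
  exact h1

lemma integrableOn_psi_mul_cpow {s : ℂ} (hs : 1 < s.re) :
    IntegrableOn (fun t : ℝ => ((Chebyshev.psi t : ℝ) : ℂ) * (t:ℂ) ^ (-s - 1)) (Ioi 1) := by
  have h1 : IntegrableOn (fun t : ℝ => (Real.log 4 + 4) * t ^ (-s.re)) (Ioi 1) :=
    (integrableOn_Ioi_rpow_of_lt (by linarith) (by norm_num)).const_mul _
  refine Integrable.mono' h1 ?_ ?_
  · refine ((Complex.measurable_ofReal.comp Chebyshev.psi_mono.measurable).aestronglyMeasurable).mul ?_
    refine ContinuousOn.aestronglyMeasurable (fun t ht => ?_) measurableSet_Ioi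
    have : (0:ℝ) < t := by have := Set.mem_Ioi.1 ht; linarith
    exact (continuousAt_ofReal_cpow_const _ _ (Or.inr this.ne')).continuousWithinAt
  · filter_upwards [ae_restrict_mem measurableSet_Ioi] with t ht
    have h0 : (0:ℝ) < t := by have := Set.mem_Ioi.1 ht; linarith
    rw [norm_mul, Complex.norm_real, norm_cpow_eq_rpow_re_of_pos h0,
      Real.norm_of_nonneg (Chebyshev.psi_nonneg t)]
    simp only [sub_re, neg_re, one_re]
    have := Chebyshev.psi_le_const_mul_self h0.le
    calc _ ≤ ((Real.log 4 + 4) * t) * t ^ (-s.re - 1) := by gcongr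
      _ = _ := by rw [Real.rpow_sub_one h0.ne']; field_simp

lemma psiTransform_eq_mellin {s : ℂ} (hs : 1 < s.re) : psiTransform s = mellin psiErr (-s) := by
  have h0 : s ≠ 0 := by rintro rfl; norm_num at hs
  have h1 : s ≠ 1 := by rintro rfl; norm_num at hs
  have hz := riemannZeta_ne_zero_of_one_le_re hs.le
  have hψ := integrableOn_psi_mul_cpow hs
  have hx : IntegrableOn (fun t : ℝ => (t:ℂ) ^ (-s)) (Ioi 1) :=
    integrableOn_Ioi_cpow_of_lt (by simpa using hs) (by norm_num)
  have hL := LSeries_eq_mul_integral_of_nonneg (fun n => ArithmeticFunction.vonMangoldt n)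
    zero_le_one hs sum_vonMangoldt_isBigO (fun n => ArithmeticFunction.vonMangoldt_nonneg)
  rw [ArithmeticFunction.LSeries_vonMangoldt_eq_deriv_riemannZeta_div hs] at hL
  have e1 : mellin psiErr (-s) = ∫ t in Ioi (1:ℝ), (((Chebyshev.psi t : ℝ) : ℂ) * (t:ℂ) ^ (-s - 1)
      - (t:ℂ) ^ (-s)) := by
    rw [mellin, setIntegral_eq_of_subset_of_forall_sdiff_eq_zero (s := Ioi (1:ℝ)) measurableSet_Ioi
      (Ioi_subset_Ioi zero_le_one)]
    · apply setIntegral_congr_fun measurableSet_Ioi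
      intro t ht
      have ht1 : 1 < t := ht
      have ht0 : (t:ℂ) ≠ 0 := by exact_mod_cast (by linarith : t ≠ 0)
      simp only [psiErr_of_gt ht1, smul_eq_mul]
      rw [cpow_sub _ _ ht0, cpow_one]
      push_cast
      field_simp
    · intro t ht
      have : t ≤ 1 := not_lt.1 ht.2
      simp [psiErr_of_le this]
  rw [e1, integral_sub hψ hx, integral_Ioi_cpow_of_lt (by simpa using hs) (by norm_num),
    psiTransform_eq h0 h1 hz]
  have e2 : ∫ t in Ioi (1:ℝ), ((Chebyshev.psi t : ℝ) : ℂ) * (t:ℂ) ^ (-s - 1) =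
      ∫ t in Ioi (1:ℝ), (∑ k ∈ Finset.Icc 1 ⌊t⌋₊, ((ArithmeticFunction.vonMangoldt k : ℝ) : ℂ))
        * t ^ (-(s + 1)) := by
    apply setIntegral_congr_fun measurableSet_Ioi
    intro t ht
    simp only [Chebyshev.psi]
    push_cast
    rw [show -(s + 1) = -s - 1 by ring]
    rfl
  rw [e2]
  set J := ∫ t in Ioi (1:ℝ), (∑ k ∈ Finset.Icc 1 ⌊t⌋₊, ((ArithmeticFunction.vonMangoldt k : ℝ) : ℂ))
        * (t:ℂ) ^ (-(s + 1))
  have e3 : J = -(deriv riemannZeta s / (s * riemannZeta s)) := by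
    have : s * J = - deriv riemannZeta s / riemannZeta s := hL.symm
    rw [eq_div_iff hz] at this
    field_simp
    linear_combination this
  rw [e3]
  have h1' := sub_ne_zero.2 h1
  have h1'' : 1 - s ≠ 0 := sub_ne_zero.2 h1.symm
  simp only [ofReal_one, one_cpow]
  rw [show -s + 1 = -(s - 1) by ring]
  field_simp

lemma hasDerivAt_mellin_of_norm_le {f : ℝ → ℂ} (hfm : Measurable f) (h1 : ∀ x ≤ 1, f x = 0)
    {C r : ℝ} (hf : ∀ x, 1 < x → ‖f x‖ ≤ C * x ^ r) {s : ℂ} (hs : r < s.re) :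
    HasDerivAt (mellin f) (mellin (fun t => Real.log t • f t) (-s)) (-s) := by
  have hloc : LocallyIntegrableOn f (Ioi 0) := by
    rw [locallyIntegrableOn_iff isOpen_Ioi.isLocallyClosed]
    intro K hK hKc
    obtain ⟨M, hM⟩ : ∃ M, ∀ x ∈ K, ‖f x‖ ≤ M := by
      have hc : ContinuousOn (fun x : ℝ => C * x ^ r) K := by
        refine continuousOn_const.mul (continuousOn_id.rpow_const fun x hx => ?_)
        exact Or.inl (ne_of_gt (hK hx))
      obtain ⟨M, hM⟩ := (hKc.image_of_continuousOn hc).bddAbove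
      refine ⟨max M 0, fun x hx => ?_⟩
      rcases le_or_gt x 1 with h | h
      · rw [h1 x h]; simp
      · exact (hf x h).trans ((hM ⟨x, hx, rfl⟩).trans (le_max_left _ _))
    refine Measure.integrableOn_of_bounded (M := M) hKc.measure_lt_top.ne hfm.aestronglyMeasurable ?_
    filter_upwards [ae_restrict_mem hKc.measurableSet] with x hx using hM x hx
  refine (mellin_hasDerivAt_of_isBigO_rpow (a := -r) (b := -s.re - 1) hloc ?_ (by simpa using hs)
    ?_ (by simp)).2
  · refine Asymptotics.IsBigO.of_bound C ?_
    filter_upwards [eventually_gt_atTop 1] with x hx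
    have := hf x hx
    rw [neg_neg, Real.norm_of_nonneg (Real.rpow_nonneg (by linarith) _)]
    exact this
  · refine Asymptotics.IsBigO.of_bound 1 ?_
    filter_upwards [nhdsWithin_le_nhds (Iic_mem_nhds (zero_lt_one (α := ℝ)))] with x hx
    rw [h1 x hx]
    simp

lemma iteratedDeriv_psiTransform_eq_mellin {s : ℂ} (hs : 1 < s.re) :
    iteratedDeriv 2 psiTransform s =
      mellin (fun t => Real.log t • (Real.log t • psiErr t)) (-s) := by
  have d1 : ∀ s : ℂ, 1 < s.re →
      HasDerivAt psiTransform (-mellin (fun t => Real.log t • psiErr t) (-s)) s := by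
    intro s hs
    have h := hasDerivAt_mellin_of_norm_le measurable_psiErr (fun x hx => psiErr_of_le hx)
      (C := 7) (r := 1) (fun x hx => by
        rw [Real.rpow_one]; exact norm_psiErr_le x (by linarith)) hs
    have h2 := h.scomp s (hasDerivAt_neg s)
    have hev : psiTransform =ᶠ[𝓝 s] (mellin psiErr ∘ Neg.neg) := by
      filter_upwards [(isOpen_lt continuous_const continuous_re).mem_nhds hs] with w hw
      exact psiTransform_eq_mellin hw
    simpa using h2.congr_of_eventuallyEq hev
  have hev : deriv psiTransform =ᶠ[𝓝 s]
      (fun w => -mellin (fun t => Real.log t • psiErr t) (-w)) := by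
    filter_upwards [(isOpen_lt continuous_const continuous_re).mem_nhds hs] with w hw
    exact (d1 w hw).deriv
  rw [iteratedDeriv_succ, iteratedDeriv_one, hev.deriv_eq]
  set δ := (s.re - 1) / 2 with hδ
  have hδ0 : 0 < δ := by rw [hδ]; linarith
  have h := hasDerivAt_mellin_of_norm_le (f := fun t => Real.log t • psiErr t)
    (Real.measurable_log.smul measurable_psiErr)
    (fun x hx => by simp [psiErr_of_le hx]) (C := 7 / δ) (r := 1 + δ) (fun x hx => by
      rw [norm_smul, Real.norm_of_nonneg (Real.log_nonneg hx.le)]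
      have h1 := Real.log_le_rpow_div (x := x) (by linarith) hδ0
      have h2 := norm_psiErr_le x (by linarith)
      calc _ ≤ (x ^ δ / δ) * (7 * x) := by gcongr
        _ = _ := by rw [Real.rpow_add (by linarith), Real.rpow_one]; ring) (s := s)
      (by rw [hδ]; linarith)
  have h2 : HasDerivAt (fun w => -mellin (fun t => Real.log t • psiErr t) (-w)) _ s :=
    (h.scomp s (hasDerivAt_neg s)).neg
  simpa using h2.deriv

lemma integrable_one_add_abs_rpow : Integrable fun ξ : ℝ => (1 + |ξ|) ^ (-(7 / 5) : ℝ) := by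
  simpa using integrable_one_add_norm (E := ℝ) (μ := volume) (r := 7 / 5) (by norm_num)

/-- Plancherel by duality: a bound for the pairing of a function with Schwartz functions in terms
of the decay of its Fourier transform. -/
lemma norm_integral_mul_schwartz_le {F : ℝ → ℂ} (hF : Integrable F) {C : ℝ}
    (hFC : ∀ ξ, ‖𝓕 F ξ‖ ≤ C * (1 + |ξ|) ^ (-(7 / 10) : ℝ)) (w : 𝓢(ℝ, ℂ)) {l : ℝ} (hl : 0 < l) :
    ‖∫ u, F u * w u‖ ≤ (l * (C ^ 2 * ∫ ξ : ℝ, (1 + |ξ|) ^ (-(7 / 5) : ℝ)) +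
      l⁻¹ * ∫ u, ‖w u‖ ^ 2) / 2 := by
  set v : 𝓢(ℝ, ℂ) := 𝓕⁻ w with hv
  have hw : 𝓕 v = w := FourierTransform.fourier_fourierInv_eq w
  have e1 : ∫ ξ, 𝓕 F ξ * v ξ = ∫ u, F u * w u := by
    have := VectorFourier.integral_fourierIntegral_smul_eq_flip (L := innerₗ ℝ) (μ := volume)
      (ν := volume) Real.continuous_fourierChar continuous_inner hF v.integrable
    rw [← hw, SchwartzMap.fourier_coe]
    simpa using! this
  have hi2 : Integrable fun u => ‖v u‖ ^ 2 := (v.memLp 2).integrable_norm_pow (by norm_num)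
  rw [← e1, ← hw, SchwartzMap.integral_norm_sq_fourier, ← integral_const_mul, ← integral_const_mul,
    ← integral_const_mul, ← integral_add ((integrable_one_add_abs_rpow.const_mul _).const_mul _)
      (hi2.const_mul _), ← integral_div]
  refine norm_integral_le_of_norm_le
    ((((integrable_one_add_abs_rpow.const_mul _).const_mul _).add (hi2.const_mul _)).div_const _)
    (Eventually.of_forall fun ξ => ?_)
  rw [norm_mul]
  set a := (1 + |ξ|) ^ (-(7 / 10) : ℝ) with ha
  have ha2 : (1 + |ξ|) ^ (-(7 / 5) : ℝ) = a ^ 2 := by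
    rw [ha, ← Real.rpow_natCast, ← Real.rpow_mul (by positivity)]; norm_num
  rw [ha2]
  set b := ‖v ξ‖
  have h1 : ‖𝓕 F ξ‖ * b ≤ C * a * b := by gcongr; exact hFC ξ
  have h2 : C * a * b ≤ (l * (C ^ 2 * a ^ 2) + l⁻¹ * b ^ 2) / 2 := by
    have : 0 ≤ l⁻¹ * (l * (C * a) - b) ^ 2 := by positivity
    have e : l⁻¹ * (l * (C * a) - b) ^ 2 = l * (C ^ 2 * a ^ 2) + l⁻¹ * b ^ 2 - 2 * (C * a * b) := by
      field_simp; ring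
    linarith
  exact h1.trans h2

/-- `(ψ(x) - x) x^{-σ} log² x` in the variable `u = -log x`. -/
noncomputable def psiWave (σ u : ℝ) : ℂ :=
  Real.exp (σ * u) • (Real.log (Real.exp (-u)) • (Real.log (Real.exp (-u)) • psiErr (Real.exp (-u))))

lemma psiWave_of_nonneg {σ u : ℝ} (hu : 0 ≤ u) : psiWave σ u = 0 := by
  rw [psiWave, psiErr_of_le (by rw [Real.exp_le_one_iff]; linarith)]
  simp

lemma psiWave_re_of_neg {σ u : ℝ} (hu : u < 0) : (psiWave σ u).re =
    Real.exp (σ * u) * (u ^ 2 * (Chebyshev.psi (Real.exp (-u)) - Real.exp (-u))) := by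
  rw [psiWave, psiErr_of_gt (by rw [Real.one_lt_exp_iff]; linarith), Real.log_exp]
  simp only [real_smul, ← ofReal_mul, ofReal_re]
  ring

lemma integrable_psiWave {σ : ℝ} (hσ : 1 < σ) : Integrable (psiWave σ) := by
  set a := (σ - 1) / 2 with ha
  have ha0 : 0 < a := by rw [ha]; linarith
  have hI : IntegrableOn (fun u : ℝ => 14 / a ^ 2 * Real.exp (a * u)) (Iic 0) := by
    have := (integrableOn_exp_mul_complex_Iic (a := (a:ℂ)) (by simpa using ha0) 0).norm
    refine Integrable.const_mul (this.congr (Eventually.of_forall fun u => ?_)) _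
    simp [Complex.norm_exp]
  have hI2 : Integrable ((Iic (0:ℝ)).indicator fun u : ℝ => 14 / a ^ 2 * Real.exp (a * u)) :=
    (integrable_indicator_iff measurableSet_Iic).2 hI
  refine hI2.mono' ?_ (Eventually.of_forall fun u => ?_)
  · have h1 : Measurable fun u : ℝ => Real.exp (-u) := by fun_prop
    have h2 : Measurable fun u : ℝ => Real.log (Real.exp (-u)) := Real.measurable_log.comp h1
    exact (((by fun_prop : Measurable fun u : ℝ => Real.exp (σ * u))).smul
      (h2.smul (h2.smul (measurable_psiErr.comp h1)))).aestronglyMeasurable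
  · rcases le_or_gt 0 u with hu | hu
    · rw [psiWave_of_nonneg hu, norm_zero]
      exact indicator_nonneg (fun _ _ => by positivity) _
    · rw [indicator_of_mem (by simpa using hu.le), psiWave, Real.log_exp, norm_smul, norm_smul,
        norm_smul, Real.norm_of_nonneg (Real.exp_nonneg _), norm_neg]
      have h1 := norm_psiErr_le (Real.exp (-u)) (Real.exp_nonneg _)
      have h2 := Real.quadratic_le_exp_of_nonneg (x := -(a * u)) (by nlinarith)
      have h3 : u ^ 2 ≤ 2 / a ^ 2 * Real.exp (-(a * u)) := by
        rw [div_mul_eq_mul_div, le_div_iff₀ (by positivity)]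
        nlinarith
      calc Real.exp (σ * u) * (‖u‖ * (‖u‖ * ‖psiErr (Real.exp (-u))‖))
          = Real.exp (σ * u) * (u ^ 2 * ‖psiErr (Real.exp (-u))‖) := by
            rw [Real.norm_eq_abs, ← mul_assoc |u|, abs_mul_abs_self, sq]
        _ ≤ Real.exp (σ * u) * (2 / a ^ 2 * Real.exp (-(a * u)) * (7 * Real.exp (-u))) := by gcongr
        _ = 14 / a ^ 2 * (Real.exp (σ * u) * Real.exp (-(a * u)) * Real.exp (-u)) := by ring
        _ = 14 / a ^ 2 * Real.exp (a * u) := by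
            rw [← Real.exp_add, ← Real.exp_add]
            congr 2
            rw [ha]; ring

lemma fourier_psiWave {σ : ℝ} (hσ : 1 < σ) (ξ : ℝ) :
    𝓕 (psiWave σ) ξ = iteratedDeriv 2 psiTransform ⟨σ, -(2 * Real.pi * ξ)⟩ := by
  rw [iteratedDeriv_psiTransform_eq_mellin hσ, mellin_eq_fourier]
  have : (-(⟨σ, -(2 * Real.pi * ξ)⟩ : ℂ)).im / (2 * Real.pi) = ξ := by
    simp
  rw [this]
  simp only [neg_re, neg_neg]
  rfl

lemma norm_fourier_psiWave_le : ∃ C > 0, ∀ σ : ℝ, 1 < σ → σ ≤ 2 → ∀ ξ : ℝ,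
    ‖𝓕 (psiWave σ) ξ‖ ≤ C * (1 + |ξ|) ^ (-(7 / 10) : ℝ) := by
  obtain ⟨C, hC, h⟩ := norm_iteratedDeriv_psiTransform_le
  refine ⟨C, hC, fun σ h1 h2 ξ => ?_⟩
  rw [fourier_psiWave h1]
  refine (h _ h1.le h2).trans (mul_le_mul_of_nonneg_left ?_ hC.le)
  refine Real.rpow_le_rpow_of_nonpos (by positivity) ?_ (by norm_num)
  rw [abs_neg, abs_mul]
  have : 1 ≤ |2 * Real.pi| := by
    rw [abs_of_pos (by positivity)]
    have := Real.pi_gt_three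
    linarith
  have := abs_nonneg ξ
  nlinarith

/-- `psiWave` cannot stay large on a window. -/
lemma psiWave_window : ∃ B > 0, ∀ σ : ℝ, 1 < σ → σ ≤ 2 → ∀ e : ℝ, |e| ≤ 1 → ∀ c δ m : ℝ, 0 < δ →
    0 < m → (∀ u, |u - c| ≤ δ → m ≤ e * (psiWave σ u).re) → m * √δ ≤ B := by
  obtain ⟨C, hC, h⟩ := norm_fourier_psiWave_le
  set A := ∫ ξ : ℝ, (1 + |ξ|) ^ (-(7 / 5) : ℝ) with hA
  have hA0 : 0 ≤ A := integral_nonneg fun ξ => by positivity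
  refine ⟨(C ^ 2 * A + 2) / 2, by positivity, fun σ h1 h2 e he c δ m hδ hm hw => ?_⟩
  let f : ContDiffBump c := ⟨δ / 2, δ, by linarith, by linarith⟩
  have hcs : HasCompactSupport fun u : ℝ => ((f u : ℝ) : ℂ) :=
    f.hasCompactSupport.comp_left (g := Complex.ofReal) Complex.ofReal_zero
  have hsm : ContDiff ℝ ∞ fun u : ℝ => ((f u : ℝ) : ℂ) := ofRealCLM.contDiff.comp f.contDiff
  let w : 𝓢(ℝ, ℂ) := hcs.toSchwartzMap hsm
  have hwf : ∀ u, w u = ((f u : ℝ) : ℂ) := fun u => rfl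
  have key := norm_integral_mul_schwartz_le (integrable_psiWave h1) (h σ h1 h2) w
    (l := √δ) (by positivity)
  have up : ∫ u, ‖w u‖ ^ 2 ≤ 2 * δ := by
    have hi2 : Integrable fun u => ‖w u‖ ^ 2 := (w.memLp 2).integrable_norm_pow (by norm_num)
    have hi : Integrable ((Metric.closedBall c δ).indicator fun _ => (1:ℝ)) :=
      (integrable_indicator_iff Metric.isClosed_closedBall.measurableSet).2
        (integrableOn_const (by rw [Real.volume_closedBall]; exact ENNReal.ofReal_ne_top))
    calc _ ≤ ∫ u, (Metric.closedBall c δ).indicator (fun _ => (1:ℝ)) u := by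
          refine integral_mono hi2 hi fun u => ?_
          simp only [hwf, norm_real]
          by_cases hu : u ∈ Metric.closedBall c δ
          · rw [indicator_of_mem hu, Real.norm_of_nonneg f.nonneg]
            exact pow_le_one₀ f.nonneg f.le_one
          · rw [indicator_of_notMem hu, f.zero_of_le_dist]
            · simp
            · rw [Metric.mem_closedBall] at hu; exact (not_le.1 hu).le
      _ = 2 * δ := by
          rw [integral_indicator_const _ Metric.isClosed_closedBall.measurableSet, measureReal_def,
            Real.volume_closedBall, ENNReal.toReal_ofReal (by linarith)]
          simp
  have low : m * δ ≤ ‖∫ u, psiWave σ u * w u‖ := by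
    have hi : Integrable fun u => psiWave σ u * w u := by
      refine (integrable_psiWave h1).mul_bdd (c := 1) w.continuous.aestronglyMeasurable
        (Eventually.of_forall fun u => ?_)
      rw [hwf, norm_real, Real.norm_of_nonneg f.nonneg]
      exact f.le_one
    have hre : (∫ u, psiWave σ u * w u).re = ∫ u, (psiWave σ u).re * f u := by
      have := integral_re hi
      simp only [RCLike.re_eq_complex_re] at this
      rw [← this]
      congr 1 with u
      rw [hwf, re_mul_ofReal]
    have hi' : Integrable fun u => (psiWave σ u).re * f u := by
      refine hi.re.congr (Eventually.of_forall fun u => ?_)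
      simp [hwf]
    have hind : Integrable ((Metric.closedBall c (δ / 2)).indicator fun _ => m) :=
      (integrable_indicator_iff Metric.isClosed_closedBall.measurableSet).2
        (integrableOn_const (by rw [Real.volume_closedBall]; exact ENNReal.ofReal_ne_top))
    have : m * δ ≤ e * ∫ u, (psiWave σ u).re * f u := by
      rw [← integral_const_mul]
      calc m * δ = ∫ u, (Metric.closedBall c (δ / 2)).indicator (fun _ => m) u := by
            rw [integral_indicator_const _ Metric.isClosed_closedBall.measurableSet, measureReal_def,
              Real.volume_closedBall, ENNReal.toReal_ofReal (by linarith), smul_eq_mul]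
            ring
        _ ≤ _ := by
            refine integral_mono hind (hi'.const_mul e) fun u => ?_
            simp only
            by_cases hu : |u - c| ≤ δ
            · have hb := hw u hu
              by_cases hu2 : u ∈ Metric.closedBall c (δ / 2)
              · rw [indicator_of_mem hu2, f.one_of_mem_closedBall hu2]
                linarith
              · rw [indicator_of_notMem hu2, ← mul_assoc]
                exact mul_nonneg (hm.le.trans hb) f.nonneg
            · have hu2 : u ∉ Metric.closedBall c (δ / 2) := by
                intro hmem
                rw [Metric.mem_closedBall, Real.dist_eq] at hmem
                linarith
              rw [indicator_of_notMem hu2, f.zero_of_le_dist (by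
                rw [Real.dist_eq]; exact (not_le.1 hu).le)]
              simp
    calc m * δ ≤ _ := this
      _ ≤ |e * ∫ u, (psiWave σ u).re * f u| := le_abs_self _
      _ = |e| * |(∫ u, psiWave σ u * w u).re| := by rw [abs_mul, hre]
      _ ≤ 1 * ‖∫ u, psiWave σ u * w u‖ := by
          gcongr
          exact abs_re_le_norm _
      _ = _ := one_mul _
  have hs : 0 < √δ := Real.sqrt_pos.2 hδ
  have hss : √δ * √δ = δ := Real.mul_self_sqrt hδ.le
  have h3 : (√δ)⁻¹ * ∫ u, ‖w u‖ ^ 2 ≤ 2 * √δ := by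
    rw [inv_mul_le_iff₀ hs]
    calc _ ≤ _ := up
      _ = _ := by linear_combination (-2) * hss
  have h4 : √δ * (m * √δ) ≤ √δ * ((C ^ 2 * A + 2) / 2) := by
    calc √δ * (m * √δ) = m * δ := by linear_combination m * hss
      _ ≤ _ := low.trans key
      _ ≤ (√δ * (C ^ 2 * A) + 2 * √δ) / 2 := by gcongr
      _ = _ := by ring
  exact le_of_mul_le_mul_left h4 hs

lemma exp_mul_ge {x u : ℝ} (hx : 0 < x) (hx4 : 4 ≤ Real.log x) (h2 : -u ≤ Real.log x + 1 / 4) :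
    Real.exp (-2) / x ≤ Real.exp ((1 + 1 / Real.log x) * u) := by
  set L := Real.log x
  have hL : 0 < L := by linarith
  rw [← Real.exp_log hx, ← Real.exp_sub, Real.exp_le_exp]
  have : 1 / L * (-u) ≤ 1 / L * (L + 1 / 4) := by gcongr
  have h3 : 1 / L * (L + 1 / 4) = 1 + 1 / 4 * (1 / L) := by field_simp
  have h4 : 1 / L ≤ 1 / 4 := by gcongr
  nlinarith

/-- The prime number theorem with a logarithmic saving, for `ψ`. -/
theorem eventually_abs_psi_sub_le : ∃ X : ℝ, ∀ x ≥ X, |Chebyshev.psi x - x| ≤ x / Real.log x := by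
  obtain ⟨B, hB, h⟩ := psiWave_window
  set D := 8 * B / Real.exp (-2) with hD
  refine ⟨Real.exp (max 4 (8 * D ^ 2 + 1)), fun x hxX => ?_⟩
  have hx : 0 < x := (Real.exp_pos _).trans_le hxX
  have hmax : max 4 (8 * D ^ 2 + 1) ≤ Real.log x := (Real.le_log_iff_exp_le hx).2 hxX
  set L := Real.log x with hL
  have hL4 : 4 ≤ L := (le_max_left _ _).trans hmax
  have hLD : 8 * D ^ 2 + 1 ≤ L := (le_max_right _ _).trans hmax
  have hL0 : 0 < L := by linarith
  have hLx : Real.exp L = x := Real.exp_log hx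
  set κ := 1 / L with hκ
  have hκ0 : 0 < κ := by positivity
  have hκ1 : κ ≤ 1 / 4 := by rw [hκ]; gcongr
  have hκL : κ * L = 1 := by rw [hκ]; field_simp
  have contra : ∀ e : ℝ, |e| ≤ 1 → ∀ c : ℝ,
      ¬ ∀ u, |u - c| ≤ κ / 8 → Real.exp (-2) * L / 8 ≤ e * (psiWave (1 + 1 / L) u).re := by
    intro e he c hcon
    have := h (1 + 1 / L) (by linarith) (by linarith) e he c (κ / 8) (Real.exp (-2) * L / 8)
      (by positivity) (by positivity) hcon
    have h1 : L * √(κ / 8) ≤ D := by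
      rw [hD, le_div_iff₀ (Real.exp_pos _)]
      linarith
    have h2 : (L * √(κ / 8)) ^ 2 ≤ D ^ 2 := by gcongr
    rw [mul_pow, Real.sq_sqrt (by positivity)] at h2
    have h3 : L ^ 2 * (κ / 8) = L / 8 := by linear_combination L / 8 * hκL
    linarith
  have exκ : Real.exp (κ / 4) ≤ 1 + κ / 2 := by
    have h1 := Real.exp_bound_div_one_sub_of_interval (x := κ / 4) (by linarith) (by linarith)
    refine h1.trans ?_
    rw [div_le_iff₀ (by linarith)]
    nlinarith
  have exκ' : 1 - κ / 4 ≤ Real.exp (-(κ / 4)) := by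
    have := Real.add_one_le_exp (-(κ / 4)); linarith
  by_contra! hlt
  have hxL : x / L = x * κ := by rw [hκ]; field_simp
  rw [hxL] at hlt
  rcases lt_abs.1 hlt with h1 | h1
  · refine contra 1 (by simp) (-(L + κ / 8)) fun u hu => ?_
    rw [abs_le] at hu
    have hu1 : L ≤ -u := by linarith
    have hu2 : -u ≤ L + κ / 4 := by linarith
    rw [one_mul, psiWave_re_of_neg (by linarith)]
    have m1 : x ≤ Real.exp (-u) := by rw [← hLx]; exact Real.exp_le_exp.2 hu1
    have m2 := Chebyshev.psi_mono m1
    have m3 : Real.exp (-u) ≤ x * (1 + κ / 2) := by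
      calc Real.exp (-u) ≤ Real.exp (L + κ / 4) := Real.exp_le_exp.2 hu2
        _ = x * Real.exp (κ / 4) := by rw [Real.exp_add, hLx]
        _ ≤ _ := by gcongr
    have m4 : x * κ / 2 ≤ Chebyshev.psi (Real.exp (-u)) - Real.exp (-u) := by linarith
    have m5 : L ^ 2 / 4 ≤ u ^ 2 := by nlinarith
    calc Real.exp (-2) * L / 8 = Real.exp (-2) / x * (L ^ 2 / 4 * (x * κ / 2)) := by
          rw [hκ]; field_simp; norm_num
      _ ≤ _ := by
          gcongr
          exact exp_mul_ge hx hL4 (by linarith)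
  · refine contra (-1) (by simp) (-(L - κ / 8)) fun u hu => ?_
    rw [abs_le] at hu
    have hu1 : -u ≤ L := by linarith
    have hu2 : L - κ / 4 ≤ -u := by linarith
    rw [psiWave_re_of_neg (by linarith)]
    have m1 : Real.exp (-u) ≤ x := by rw [← hLx]; exact Real.exp_le_exp.2 hu1
    have m2 := Chebyshev.psi_mono m1
    have m3 : x * (1 - κ / 4) ≤ Real.exp (-u) := by
      calc x * (1 - κ / 4) ≤ x * Real.exp (-(κ / 4)) := by gcongr
        _ = Real.exp (L - κ / 4) := by rw [sub_eq_add_neg, Real.exp_add, hLx]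
        _ ≤ _ := Real.exp_le_exp.2 hu2
    have m4 : x * κ / 2 ≤ -(Chebyshev.psi (Real.exp (-u)) - Real.exp (-u)) := by nlinarith
    have m5 : L ^ 2 / 4 ≤ u ^ 2 := by nlinarith
    calc Real.exp (-2) * L / 8 = Real.exp (-2) / x * (L ^ 2 / 4 * (x * κ / 2)) := by
          rw [hκ]; field_simp; norm_num
      _ ≤ Real.exp ((1 + 1 / L) * u) *
          (u ^ 2 * -(Chebyshev.psi (Real.exp (-u)) - Real.exp (-u))) := by
          gcongr
          exact exp_mul_ge hx hL4 (by linarith)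
      _ = _ := by ring

/-- The prime number theorem with a logarithmic saving, for `θ`. -/
theorem abs_theta_sub_le : ∃ C > 0, ∀ x : ℝ, 2 ≤ x →
    |Chebyshev.theta x - x| ≤ C * (x / Real.log x) := by
  obtain ⟨X, hX⟩ := eventually_abs_psi_sub_le
  obtain ⟨K, hK⟩ := Chebyshev.psi_sub_theta_le_mul_sqrt
  set Y := max X 2 with hY
  have hY1 : 0 ≤ Real.log Y := Real.log_nonneg (by linarith [le_max_right X 2])
  refine ⟨(1 + 2 * |K|) + 3 * Real.log Y, by positivity, fun x hx => ?_⟩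
  have hx0 : 0 < x := by linarith
  have hL : 0 < Real.log x := Real.log_pos (by linarith)
  have hxL : 0 < x / Real.log x := by positivity
  rcases le_total x Y with hxY | hxY
  · have h1 : |Chebyshev.theta x - x| ≤ 3 * x := by
      have h2 := Chebyshev.theta_nonneg x
      have h3 := Chebyshev.theta_le_log4_mul_x hx0.le
      have h4 : Real.log 4 ≤ 2 := by
        rw [show (4:ℝ) = 2 ^ 2 by norm_num, Real.log_pow]
        have := Real.log_two_lt_d9
        push_cast; linarith
      rw [abs_le]; constructor <;> nlinarith
    have h2 : Real.log x ≤ Real.log Y := Real.log_le_log hx0 hxY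
    have h3 : x ≤ Real.log Y * (x / Real.log x) := by
      rw [← mul_div_assoc, le_div_iff₀ hL]; nlinarith
    have h4 : 0 ≤ (1 + 2 * |K|) * (x / Real.log x) := by positivity
    calc _ ≤ _ := h1
      _ ≤ _ := by nlinarith
  · have h1 := hX x ((le_max_left _ _).trans hxY)
    have h2 := hK x
    have h3 := Chebyshev.theta_le_psi x
    have h4 : √x ≤ 2 * (x / Real.log x) := by
      rw [← mul_div_assoc, le_div_iff₀ hL]
      have h5 := Real.log_le_rpow_div hx0.le (ε := 1 / 2) (by norm_num)
      rw [← Real.sqrt_eq_rpow] at h5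
      have h6 := Real.mul_self_sqrt hx0.le
      have h7 := Real.sqrt_nonneg x
      nlinarith
    have h5 : K * √x ≤ |K| * (2 * (x / Real.log x)) := by
      refine mul_le_mul (le_abs_self K) h4 (Real.sqrt_nonneg _) (abs_nonneg _)
    have h6 : 0 ≤ 3 * Real.log Y * (x / Real.log x) := by positivity
    rw [abs_le] at h1 ⊢
    constructor <;> nlinarith

lemma theta_eq_sum_Icc_ite (t : ℝ) :
    ∑ k ∈ Finset.Icc 0 ⌊t⌋₊, (if k.Prime then Real.log k else 0) = Chebyshev.theta t := by
  rw [Chebyshev.theta_eq_sum_Icc, Finset.sum_filter]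

lemma continuousOn_rpow_Icc {a b : ℝ} (ha : 0 < a) (γ : ℝ) :
    ContinuousOn (fun t : ℝ => t ^ γ) (Icc a b) :=
  fun t ht => (Real.continuousAt_rpow_const _ _ (Or.inl (by linarith [ht.1]))).continuousWithinAt

/-- Abel summation against `θ` for the weight `t ^ γ`. -/
lemma sum_rpow_mul_log_eq {a b : ℝ} (ha : 0 < a) (hab : a ≤ b) (γ : ℝ) :
    ∑ k ∈ Finset.Ioc ⌊a⌋₊ ⌊b⌋₊, (k : ℝ) ^ γ * (if k.Prime then Real.log k else 0) =
      b ^ γ * Chebyshev.theta b - a ^ γ * Chebyshev.theta a -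
        ∫ t in a..b, γ * t ^ (γ - 1) * Chebyshev.theta t := by
  have hd : ∀ t : ℝ, 0 < t → HasDerivAt (fun t : ℝ => t ^ γ) (γ * t ^ (γ - 1)) t :=
    fun t ht => Real.hasDerivAt_rpow_const (Or.inl ht.ne')
  have key := sum_mul_eq_sub_sub_integral_mul (f := fun t : ℝ => t ^ γ)
    (fun k : ℕ => if k.Prime then Real.log k else 0) ha.le hab
    (fun t ht => (hd t (by linarith [ht.1])).differentiableAt) (by
      refine ContinuousOn.integrableOn_Icc ?_
      refine ((continuousOn_rpow_Icc ha (γ - 1)).const_mul γ).congr fun t ht => ?_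
      exact (hd t (by linarith [ht.1])).deriv)
  simp only [theta_eq_sum_Icc_ite] at key
  rw [key, intervalIntegral.integral_of_le hab]
  congr 1
  refine setIntegral_congr_fun measurableSet_Ioc fun t ht => ?_
  rw [(hd t (by linarith [ht.1])).deriv]

/-- Partial summation with the prime number theorem for the weight `t ^ γ`. -/
lemma abs_sum_rpow_mul_log_sub_le {C : ℝ}
    (hC : ∀ x : ℝ, 2 ≤ x → |Chebyshev.theta x - x| ≤ C * (x / Real.log x))
    {a b : ℝ} (ha : 2 ≤ a) (hab : a ≤ b) {γ : ℝ} (hγ : γ ≠ -1) :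
    |∑ k ∈ Finset.Ioc ⌊a⌋₊ ⌊b⌋₊, (k : ℝ) ^ γ * (if k.Prime then Real.log k else 0) -
      (b ^ (γ + 1) - a ^ (γ + 1)) / (γ + 1)| ≤
      C * (b ^ (γ + 1) / Real.log b + a ^ (γ + 1) / Real.log a +
        |γ| * ∫ t in a..b, t ^ γ / Real.log t) := by
  have ha0 : 0 < a := by linarith
  have hb0 : 0 < b := by linarith
  have hγ' : γ + 1 ≠ 0 := fun h => hγ (by linarith)
  have hsub : uIcc a b = Icc a b := uIcc_of_le hab
  have hpow : ∀ t : ℝ, 0 < t → t ^ γ * t = t ^ (γ + 1) := fun t ht =>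
    (Real.rpow_add_one ht.ne' γ).symm
  have hpow' : ∀ t : ℝ, 0 < t → t ^ (γ - 1) * t = t ^ γ := fun t ht => by
    rw [← Real.rpow_add_one ht.ne', sub_add_cancel]
  have i1 : IntervalIntegrable (fun t => γ * t ^ (γ - 1) * Chebyshev.theta t) volume a b :=
    Chebyshev.theta_mono.intervalIntegrable.continuousOn_mul
      (by rw [hsub]; exact (continuousOn_rpow_Icc ha0 (γ - 1)).const_mul γ)
  have i2 : IntervalIntegrable (fun t => γ * t ^ γ) volume a b :=
    ContinuousOn.intervalIntegrable
      (by rw [hsub]; exact (continuousOn_rpow_Icc ha0 γ).const_mul γ)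
  have i3 : IntervalIntegrable (fun t => t ^ γ / Real.log t) volume a b :=
    ContinuousOn.intervalIntegrable (by
      rw [hsub]
      refine (continuousOn_rpow_Icc ha0 γ).div (fun t ht => ?_) fun t ht => ?_
      · exact (Real.continuousAt_log (by linarith [ht.1])).continuousWithinAt
      · exact (Real.log_pos (by linarith [ht.1])).ne')
  have main : ∫ t in a..b, γ * t ^ γ = γ * ((b ^ (γ + 1) - a ^ (γ + 1)) / (γ + 1)) := by
    rw [intervalIntegral.integral_const_mul, integral_rpow]
    right
    refine ⟨hγ, ?_⟩
    rw [hsub]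
    exact fun h => by linarith [h.1]
  have eq1 : ∑ k ∈ Finset.Ioc ⌊a⌋₊ ⌊b⌋₊, (k : ℝ) ^ γ * (if k.Prime then Real.log k else 0) -
      (b ^ (γ + 1) - a ^ (γ + 1)) / (γ + 1) =
      b ^ γ * (Chebyshev.theta b - b) - a ^ γ * (Chebyshev.theta a - a) -
      ∫ t in a..b, (γ * t ^ (γ - 1) * Chebyshev.theta t - γ * t ^ γ) := by
    rw [intervalIntegral.integral_sub i1 i2, main, sum_rpow_mul_log_eq ha0 hab, mul_sub, mul_sub,
      hpow a ha0, hpow b hb0]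
    field_simp
    ring
  have bd : ∀ t : ℝ, 2 ≤ t → |t ^ γ * (Chebyshev.theta t - t)| ≤ C * (t ^ (γ + 1) / Real.log t) := by
    intro t ht
    have ht0 : 0 < t := by linarith
    rw [abs_mul, abs_of_pos (Real.rpow_pos_of_pos ht0 γ), ← hpow t ht0]
    calc _ ≤ t ^ γ * (C * (t / Real.log t)) := by gcongr; exact hC t ht
      _ = _ := by ring
  have bint : |∫ t in a..b, (γ * t ^ (γ - 1) * Chebyshev.theta t - γ * t ^ γ)| ≤
      ∫ t in a..b, C * |γ| * (t ^ γ / Real.log t) := by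
    rw [← Real.norm_eq_abs]
    refine intervalIntegral.norm_integral_le_of_norm_le hab ?_ (i3.const_mul _)
    refine ae_of_all _ fun t ht => ?_
    have ht2 : 2 ≤ t := ha.trans ht.1.le
    have ht0 : 0 < t := by linarith
    rw [Real.norm_eq_abs, ← hpow' t ht0, show γ * t ^ (γ - 1) * Chebyshev.theta t -
      γ * (t ^ (γ - 1) * t) = γ * (t ^ (γ - 1) * (Chebyshev.theta t - t)) by ring, abs_mul, abs_mul,
      abs_of_pos (Real.rpow_pos_of_pos ht0 _)]
    calc _ ≤ |γ| * (t ^ (γ - 1) * (C * (t / Real.log t))) := by gcongr; exact hC t ht2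
      _ = _ := by ring
  rw [intervalIntegral.integral_const_mul] at bint
  rw [eq1]
  calc _ ≤ |b ^ γ * (Chebyshev.theta b - b)| + |a ^ γ * (Chebyshev.theta a - a)| + _ :=
        (abs_sub _ _).trans (add_le_add_left (abs_sub _ _) _)
    _ ≤ _ := add_le_add (add_le_add (bd b (by linarith)) (bd a ha)) bint
    _ = _ := by ring

/-- `t ^ δ / log t ^ k` is increasing up to a constant. -/
lemma rpow_div_log_pow_le {δ : ℝ} (hδ : 0 < δ) (k : ℕ) : ∃ C > 0, ∀ t y : ℝ, 2 ≤ t → t ≤ y →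
    t ^ δ / Real.log t ^ k ≤ C * (y ^ δ / Real.log y ^ k) := by
  set m : ℝ := δ / (k + 1) with hm
  have hm0 : 0 < m := by positivity
  have hl2 : 0 < Real.log 2 := Real.log_pos (by norm_num)
  set D : ℝ := 1 + 1 / (m * Real.log 2) with hD
  have hD0 : 0 < D := by positivity
  refine ⟨D ^ k, by positivity, fun t y ht hty => ?_⟩
  have ht0 : 0 < t := by linarith
  have hy0 : 0 < y := by linarith
  have hlt : Real.log 2 ≤ Real.log t := Real.log_le_log (by norm_num) ht
  have hlt0 : 0 < Real.log t := by linarith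
  have hly : Real.log t ≤ Real.log y := Real.log_le_log ht0 hty
  have hly0 : 0 < Real.log y := by linarith
  have h1 : Real.log y / Real.log t ≤ D * (y / t) ^ m := by
    have h2 : Real.log (y / t) ≤ (y / t) ^ m / m := Real.log_le_rpow_div (by positivity) hm0
    rw [Real.log_div hy0.ne' ht0.ne'] at h2
    have h3 : 1 ≤ (y / t) ^ m := Real.one_le_rpow ((one_le_div ht0).2 hty) hm0.le
    have h4 : Real.log y / Real.log t = 1 + (Real.log y - Real.log t) / Real.log t := by
      field_simp; ring
    rw [h4, hD, add_mul, one_mul]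
    refine add_le_add h3 ?_
    calc _ ≤ (Real.log y - Real.log t) / Real.log 2 := by gcongr
      _ ≤ ((y / t) ^ m / m) / Real.log 2 := by gcongr
      _ = _ := by field_simp
  have h5 : (Real.log y / Real.log t) ^ k ≤ D ^ k * (y / t) ^ δ := by
    calc _ ≤ (D * (y / t) ^ m) ^ k := by gcongr
      _ = D ^ k * (y / t) ^ (m * k) := by rw [mul_pow, Real.rpow_mul_natCast (by positivity)]
      _ ≤ _ := by
        gcongr
        · exact (one_le_div ht0).2 hty
        · rw [hm, div_mul_eq_mul_div, div_le_iff₀ (by positivity)]; nlinarith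
  rw [Real.div_rpow hy0.le ht0.le, div_pow, div_le_iff₀ (by positivity)] at h5
  have hp : 0 < t ^ δ := Real.rpow_pos_of_pos ht0 _
  rw [div_le_iff₀ (by positivity)]
  calc t ^ δ = t ^ δ * Real.log y ^ k / Real.log y ^ k := by field_simp
    _ ≤ t ^ δ * (D ^ k * (y ^ δ / t ^ δ) * Real.log t ^ k) / Real.log y ^ k := by gcongr
    _ = _ := by field_simp

/-- The primes `p ≤ y`. -/
noncomputable def primesUpTo (y : ℝ) : Finset ℕ := (Finset.Icc 2 ⌊y⌋₊).filter Nat.Prime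

lemma mem_primesUpTo {y : ℝ} {p : ℕ} : p ∈ primesUpTo y ↔ p.Prime ∧ (p : ℝ) ≤ y := by
  simp only [primesUpTo, Finset.mem_filter, Finset.mem_Icc]
  constructor
  · rintro ⟨⟨_, h⟩, hp⟩
    exact ⟨hp, (Nat.le_floor_iff' hp.ne_zero).1 h⟩
  · rintro ⟨hp, h⟩
    exact ⟨⟨hp.two_le, Nat.le_floor h⟩, hp⟩

/-- Chebyshev's upper bound. -/
lemma card_primesUpTo_le : ∃ C > 0, ∀ y : ℝ, 2 ≤ y →
    ((primesUpTo y).card : ℝ) ≤ C * (y / Real.log y) := by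
  have hl4 : 0 < Real.log 4 := Real.log_pos (by norm_num)
  refine ⟨2 * Real.log 4 + 2, by positivity, fun y hy => ?_⟩
  have hy0 : 0 < y := by linarith
  have hL : 0 < Real.log y := Real.log_pos (by linarith)
  have h1 := Chebyshev.pi_le_log4_mul_div (x := y) (by linarith)
  have h2 : (primesUpTo y).card ≤ Nat.primeCounting ⌊y⌋₊ := by
    rw [← Nat.primesLE_card_eq_primeCounting]
    refine Finset.card_le_card fun p hp => ?_
    rw [mem_primesUpTo] at hp
    rw [Nat.mem_primesLE]
    exact ⟨Nat.le_floor hp.2, hp.1⟩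
  have h2' : ((primesUpTo y).card : ℝ) ≤ (Nat.primeCounting ⌊y⌋₊ : ℝ) := by exact_mod_cast h2
  have h4 : √y ≤ 2 * (y / Real.log y) := by
    rw [← mul_div_assoc, le_div_iff₀ hL]
    have h5 := Real.log_le_rpow_div hy0.le (ε := 1 / 2) (by norm_num)
    rw [← Real.sqrt_eq_rpow] at h5
    have h6 := Real.mul_self_sqrt hy0.le
    have h7 := Real.sqrt_nonneg y
    nlinarith
  rw [Real.log_sqrt hy0.le] at h1
  have h5 : Real.log 4 * y / (Real.log y / 2) = 2 * Real.log 4 * (y / Real.log y) := by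
    field_simp
  rw [h5] at h1
  linarith

/-- Power sums over primes with logarithmic weights, positive exponent. -/
lemma abs_sum_primesUpTo_rpow_mul_log_sub_le {γ : ℝ} (hγ : 0 < γ) : ∃ C > 0, ∀ y : ℝ, 2 ≤ y →
    |∑ p ∈ primesUpTo y, (p : ℝ) ^ γ * Real.log p - y ^ (γ + 1) / (γ + 1)| ≤
      C * (y ^ (γ + 1) / Real.log y) := by
  obtain ⟨C, hC0, hC⟩ := abs_theta_sub_le
  obtain ⟨C1, hC10, hC1⟩ := rpow_div_log_pow_le (δ := γ + 1) (by linarith) 1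
  obtain ⟨C2, hC20, hC2⟩ := rpow_div_log_pow_le hγ 1
  simp only [pow_one] at hC1 hC2
  refine ⟨2 * C1 + C * (1 + C1 + γ * C2), by positivity, fun y hy => ?_⟩
  have hy0 : 0 < y := by linarith
  have hL : 0 < Real.log y := Real.log_pos (by linarith)
  have hl2 : 0 < Real.log 2 := Real.log_pos (by norm_num)
  have hl2' : Real.log 2 < 1 := Real.log_two_lt_d9.trans (by norm_num)
  have h1 := abs_sum_rpow_mul_log_sub_le hC le_rfl hy (γ := γ) (by linarith)
  have h2 := hC1 2 y le_rfl hy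
  have h3 : ∫ t in (2:ℝ)..y, t ^ γ / Real.log t ≤ C2 * (y ^ (γ + 1) / Real.log y) := by
    have hb : ‖∫ t in (2:ℝ)..y, t ^ γ / Real.log t‖ ≤ C2 * (y ^ γ / Real.log y) * |y - 2| := by
      refine intervalIntegral.norm_integral_le_of_norm_le_const fun t ht => ?_
      rw [uIoc_of_le hy] at ht
      have : 0 < Real.log t := Real.log_pos (by linarith [ht.1])
      have : 0 < t := by linarith [ht.1]
      rw [Real.norm_of_nonneg (by positivity)]
      exact hC2 t y ht.1.le ht.2
    refine (le_abs_self _).trans (hb.trans ?_)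
    rw [abs_of_nonneg (by linarith), Real.rpow_add_one hy0.ne']
    calc _ ≤ C2 * (y ^ γ / Real.log y) * y := by gcongr; linarith
      _ = _ := by ring
  have hsum : ∑ p ∈ primesUpTo y, (p : ℝ) ^ γ * Real.log p = (2 : ℝ) ^ γ * Real.log 2 +
      ∑ k ∈ Finset.Ioc ⌊(2:ℝ)⌋₊ ⌊y⌋₊, (k : ℝ) ^ γ * (if k.Prime then Real.log k else 0) := by
    have hf : ⌊(2:ℝ)⌋₊ = 2 := by simp
    have h2y : 2 ≤ ⌊y⌋₊ := Nat.le_floor (by exact_mod_cast hy)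
    rw [primesUpTo, Finset.sum_filter, hf, ← Finset.add_sum_Ioc_eq_sum_Icc h2y]
    simp [Nat.prime_two]
  rw [abs_of_pos hγ] at h1
  set W := y ^ (γ + 1) / Real.log y with hW
  set V := (2:ℝ) ^ (γ + 1) / Real.log 2 with hV
  have hp : (0:ℝ) < 2 ^ γ := Real.rpow_pos_of_pos (by norm_num) _
  have hpp : (2:ℝ) ^ (γ + 1) = 2 ^ γ * 2 := Real.rpow_add_one (by norm_num) _
  have h4 : (2:ℝ) ^ γ * Real.log 2 ≤ V := by
    rw [hV, hpp, le_div_iff₀ hl2, mul_assoc]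
    gcongr
    nlinarith
  have h5 : (2:ℝ) ^ (γ + 1) / (γ + 1) ≤ V := by
    rw [hV]; gcongr; linarith
  have h6 : 0 ≤ (2:ℝ) ^ γ * Real.log 2 := by positivity
  have h7 : 0 ≤ (2:ℝ) ^ (γ + 1) / (γ + 1) := by positivity
  have h8 : C * (W + V + γ * ∫ t in (2:ℝ)..y, t ^ γ / Real.log t) ≤
      C * (W + C1 * W + γ * (C2 * W)) := by gcongr
  rw [hsum]
  rw [sub_div, abs_le] at h1
  rw [abs_le]
  constructor <;> nlinarith

/-- Power sums over primes with inverse logarithmic weights, positive exponent. -/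
lemma abs_sum_primesUpTo_rpow_div_log_pow_sub_le {γ : ℝ} (hγ : 0 < γ) (k : ℕ) :
    ∃ C > 0, ∀ y : ℝ, 2 ≤ y →
    |∑ p ∈ primesUpTo y, (p : ℝ) ^ γ / Real.log p ^ k -
      y ^ (γ + 1) / ((γ + 1) * Real.log y ^ (k + 1))| ≤
      C * (y ^ (γ + 1) / Real.log y ^ (k + 2)) := by
  obtain ⟨C, hC0, hC⟩ := abs_sum_primesUpTo_rpow_mul_log_sub_le hγ
  obtain ⟨C1, hC10, hC1⟩ := rpow_div_log_pow_le (δ := γ / 2) (by linarith) k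
  obtain ⟨C2, hC20, hC2⟩ := card_primesUpTo_le
  refine ⟨C + C2 * ((k + 1) * (C1 * (2 / γ))), by positivity, fun y hy => ?_⟩
  have hy0 : 0 < y := by linarith
  have hL : 0 < Real.log y := Real.log_pos (by linarith)
  have hyy : y ^ γ = y ^ (γ / 2) * y ^ (γ / 2) := by rw [← Real.rpow_add hy0]; congr 1; ring
  have hterm : ∀ p ∈ primesUpTo y, |(p : ℝ) ^ γ / Real.log p ^ k -
      (p : ℝ) ^ γ * Real.log p / Real.log y ^ (k + 1)| ≤
      (k + 1) * (C1 * (2 / γ)) * (y ^ γ / Real.log y ^ (k + 1)) := by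
    intro p hp
    rw [mem_primesUpTo] at hp
    have hp2 : (2:ℝ) ≤ p := by exact_mod_cast hp.1.two_le
    have hp0 : (0:ℝ) < p := by linarith
    have hl : 0 < Real.log p := Real.log_pos (by linarith)
    have hll : Real.log p ≤ Real.log y := Real.log_le_log hp0 hp.2
    have h1 := hC1 p y hp2 hp.2
    have h2 : (p:ℝ) ^ (γ / 2) * (Real.log y - Real.log p) ≤ 2 / γ * y ^ (γ / 2) := by
      have h3 := Real.log_le_rpow_div (x := y / p) (by positivity) (ε := γ / 2) (by linarith)
      rw [Real.log_div hy0.ne' hp0.ne', Real.div_rpow hy0.le hp0.le] at h3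
      have hq : 0 < (p:ℝ) ^ (γ / 2) := Real.rpow_pos_of_pos hp0 _
      calc _ ≤ (p:ℝ) ^ (γ / 2) * (y ^ (γ / 2) / p ^ (γ / 2) / (γ / 2)) := by gcongr
        _ = _ := by field_simp
    have hpow : Real.log y ^ (k + 1) - Real.log p ^ (k + 1) ≤
        (k + 1) * ((Real.log y - Real.log p) * Real.log y ^ k) := by
      have := abs_pow_sub_pow_le (Real.log y) (Real.log p) (k + 1)
      rw [abs_of_nonneg (sub_nonneg.2 hll), abs_of_pos hL, abs_of_pos hl, max_eq_left hll,
        Nat.add_sub_cancel] at this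
      refine (le_abs_self _).trans (this.trans (le_of_eq ?_))
      push_cast; ring
    have e1 : (p : ℝ) ^ γ / Real.log p ^ k - (p : ℝ) ^ γ * Real.log p / Real.log y ^ (k + 1) =
        (p : ℝ) ^ γ / (Real.log p ^ k * Real.log y ^ (k + 1)) *
          (Real.log y ^ (k + 1) - Real.log p ^ (k + 1)) := by
      field_simp
      ring
    have hge : Real.log p ^ (k + 1) ≤ Real.log y ^ (k + 1) := by gcongr
    have hq : 0 < (p:ℝ) ^ γ := Real.rpow_pos_of_pos hp0 _
    have hpp : (p:ℝ) ^ γ = p ^ (γ / 2) * p ^ (γ / 2) := by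
      rw [← Real.rpow_add hp0]; congr 1; ring
    rw [e1, abs_of_nonneg (mul_nonneg (by positivity) (sub_nonneg.2 hge))]
    calc _ ≤ (p : ℝ) ^ γ / (Real.log p ^ k * Real.log y ^ (k + 1)) *
          ((k + 1) * ((Real.log y - Real.log p) * Real.log y ^ k)) := by gcongr
      _ = (k + 1) / Real.log y * ((p:ℝ) ^ (γ / 2) / Real.log p ^ k *
          ((p:ℝ) ^ (γ / 2) * (Real.log y - Real.log p))) := by
        rw [hpp]; field_simp; ring
      _ ≤ (k + 1) / Real.log y * (C1 * (y ^ (γ / 2) / Real.log y ^ k) *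
          (2 / γ * y ^ (γ / 2))) := by
        have := sub_nonneg.2 hll
        gcongr
      _ = _ := by rw [hyy]; field_simp; ring
  have hsum : |∑ p ∈ primesUpTo y, ((p : ℝ) ^ γ / Real.log p ^ k -
      (p : ℝ) ^ γ * Real.log p / Real.log y ^ (k + 1))| ≤
      C2 * ((k + 1) * (C1 * (2 / γ))) * (y ^ (γ + 1) / Real.log y ^ (k + 2)) := by
    refine (Finset.abs_sum_le_sum_abs _ _).trans ((Finset.sum_le_card_nsmul _ _ _ hterm).trans ?_)
    rw [nsmul_eq_mul]
    calc _ ≤ C2 * (y / Real.log y) *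
          ((k + 1) * (C1 * (2 / γ)) * (y ^ γ / Real.log y ^ (k + 1))) := by
          gcongr; exact hC2 y hy
      _ = _ := by rw [Real.rpow_add_one hy0.ne']; field_simp; ring
  have hmain : |(∑ p ∈ primesUpTo y, (p : ℝ) ^ γ * Real.log p - y ^ (γ + 1) / (γ + 1)) /
      Real.log y ^ (k + 1)| ≤ C * (y ^ (γ + 1) / Real.log y ^ (k + 2)) := by
    rw [abs_div, abs_of_pos (by positivity : 0 < Real.log y ^ (k + 1)), div_le_iff₀ (by positivity)]
    refine (hC y hy).trans (le_of_eq ?_)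
    field_simp
    ring
  calc _ = |(∑ p ∈ primesUpTo y, ((p : ℝ) ^ γ / Real.log p ^ k -
        (p : ℝ) ^ γ * Real.log p / Real.log y ^ (k + 1))) +
        (∑ p ∈ primesUpTo y, (p : ℝ) ^ γ * Real.log p - y ^ (γ + 1) / (γ + 1)) /
        Real.log y ^ (k + 1)| := by
        rw [Finset.sum_sub_distrib, ← Finset.sum_div]
        congr 1
        field_simp
        ring
    _ ≤ _ := (abs_add_le _ _).trans (add_le_add hsum hmain)
    _ = _ := by ring

lemma sum_primesUpTo_natCast {p : ℕ} (hp : p.Prime) (f : ℕ → ℝ) :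
    ∑ q ∈ primesUpTo (p : ℝ), f q = ∑ q ∈ (Finset.range p).filter Nat.Prime, f q + f p := by
  have : primesUpTo (p : ℝ) = insert p ((Finset.range p).filter Nat.Prime) := by
    ext q
    simp only [mem_primesUpTo, Finset.mem_insert, Finset.mem_filter, Finset.mem_range, Nat.cast_le]
    constructor
    · rintro ⟨h1, h2⟩
      rcases h2.eq_or_lt with h | h
      · exact Or.inl h
      · exact Or.inr ⟨h, h1⟩
    · rintro (h | h)
      · exact ⟨h ▸ hp, h.le⟩
      · exact ⟨h.2, h.1.le⟩
  rw [this, Finset.sum_insert (by simp), add_comm]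

/-- The sum of `q ^ α` over pairs of primes `q < p ≤ y`. -/
lemma abs_sum_sum_rpow_sub_le {α : ℝ} (hα : 0 < α) : ∃ C > 0, ∀ y : ℝ, 2 ≤ y →
    |∑ p ∈ primesUpTo y, ∑ q ∈ (Finset.range p).filter Nat.Prime, (q : ℝ) ^ α -
      y ^ (α + 2) / ((α + 1) * (α + 2) * Real.log y ^ 2)| ≤
      C * (y ^ (α + 2) / Real.log y ^ 3) := by
  obtain ⟨C0, hC00, hC0⟩ := abs_sum_primesUpTo_rpow_div_log_pow_sub_le hα 0
  obtain ⟨C1, hC10, hC1⟩ :=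
    abs_sum_primesUpTo_rpow_div_log_pow_sub_le (γ := α + 1) (by linarith) 1
  obtain ⟨C2, hC20, hC2⟩ :=
    abs_sum_primesUpTo_rpow_div_log_pow_sub_le (γ := α + 1) (by linarith) 2
  have hl2 : 0 < Real.log 2 := Real.log_pos (by norm_num)
  refine ⟨(C0 + 4) * (1 / (α + 2) + C2 / Real.log 2) + C1 / (α + 1), by positivity,
    fun y hy => ?_⟩
  have hy0 : 0 < y := by linarith
  have hly : Real.log 2 ≤ Real.log y := Real.log_le_log (by norm_num) hy
  have hL : 0 < Real.log y := by linarith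
  have e2 : α + 1 + 1 = α + 2 := by ring
  have hterm : ∀ p ∈ primesUpTo y, |∑ q ∈ (Finset.range p).filter Nat.Prime, (q : ℝ) ^ α -
      (p : ℝ) ^ (α + 1) / Real.log p ^ 1 / (α + 1)| ≤
      (C0 + 4) * ((p : ℝ) ^ (α + 1) / Real.log p ^ 2) := by
    intro p hp
    rw [mem_primesUpTo] at hp
    have hp2 : (2:ℝ) ≤ p := by exact_mod_cast hp.1.two_le
    have hp0 : (0:ℝ) < p := by linarith
    have hl : 0 < Real.log p := Real.log_pos (by linarith)
    have h1 := hC0 p hp2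
    simp only [pow_zero, div_one, zero_add, pow_one] at h1
    rw [sum_primesUpTo_natCast hp.1 fun q => (q : ℝ) ^ α] at h1
    have h2 : (p : ℝ) ^ α ≤ 4 * ((p : ℝ) ^ (α + 1) / Real.log p ^ 2) := by
      have h5 := Real.log_le_rpow_div hp0.le (ε := 1 / 2) (by norm_num)
      rw [← Real.sqrt_eq_rpow] at h5
      have h6 := Real.mul_self_sqrt hp0.le
      have h7 := Real.sqrt_nonneg p
      have h8 : Real.log p ^ 2 ≤ 4 * p := by nlinarith
      have : 0 < (p : ℝ) ^ α := Real.rpow_pos_of_pos hp0 _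
      rw [Real.rpow_add_one hp0.ne', ← mul_div_assoc, le_div_iff₀ (by positivity)]
      nlinarith
    have h3 : 0 ≤ (p : ℝ) ^ α := by positivity
    have h4 : (p : ℝ) ^ (α + 1) / ((α + 1) * Real.log p) =
        (p : ℝ) ^ (α + 1) / Real.log p ^ 1 / (α + 1) := by rw [pow_one]; field_simp
    rw [h4, abs_le] at h1
    rw [abs_le]
    constructor <;> linarith
  have hE : ∑ p ∈ primesUpTo y, (p : ℝ) ^ (α + 1) / Real.log p ^ 2 ≤
      (1 / (α + 2) + C2 / Real.log 2) * (y ^ (α + 2) / Real.log y ^ 3) := by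
    have h1 := (abs_le.1 (hC2 y hy)).2
    rw [e2] at h1
    have h2 : C2 * (y ^ (α + 2) / Real.log y ^ (2 + 2)) ≤
        C2 / Real.log 2 * (y ^ (α + 2) / Real.log y ^ 3) := by
      calc _ = C2 / Real.log y * (y ^ (α + 2) / Real.log y ^ 3) := by field_simp
        _ ≤ _ := by gcongr
    have h3 : y ^ (α + 2) / ((α + 2) * Real.log y ^ (2 + 1)) =
        1 / (α + 2) * (y ^ (α + 2) / Real.log y ^ 3) := by field_simp
    linarith
  have hsum : |∑ p ∈ primesUpTo y, (∑ q ∈ (Finset.range p).filter Nat.Prime, (q : ℝ) ^ α -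
      (p : ℝ) ^ (α + 1) / Real.log p ^ 1 / (α + 1))| ≤
      (C0 + 4) * ((1 / (α + 2) + C2 / Real.log 2) * (y ^ (α + 2) / Real.log y ^ 3)) := by
    refine (Finset.abs_sum_le_sum_abs _ _).trans ((Finset.sum_le_sum hterm).trans ?_)
    rw [← Finset.mul_sum]
    gcongr
  have hmain : |(∑ p ∈ primesUpTo y, (p : ℝ) ^ (α + 1) / Real.log p ^ 1 -
      y ^ (α + 1 + 1) / ((α + 1 + 1) * Real.log y ^ (1 + 1))) / (α + 1)| ≤
      C1 / (α + 1) * (y ^ (α + 2) / Real.log y ^ 3) := by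
    rw [abs_div, abs_of_pos (by positivity : 0 < α + 1), div_le_iff₀ (by positivity)]
    refine (hC1 y hy).trans (le_of_eq ?_)
    rw [e2]
    field_simp
  calc _ = |∑ p ∈ primesUpTo y, (∑ q ∈ (Finset.range p).filter Nat.Prime, (q : ℝ) ^ α -
      (p : ℝ) ^ (α + 1) / Real.log p ^ 1 / (α + 1)) +
        (∑ p ∈ primesUpTo y, (p : ℝ) ^ (α + 1) / Real.log p ^ 1 -
      y ^ (α + 1 + 1) / ((α + 1 + 1) * Real.log y ^ (1 + 1))) / (α + 1)| := by
        rw [Finset.sum_sub_distrib, ← Finset.sum_div, e2]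
        congr 1
        field_simp
        ring
    _ ≤ _ := (abs_add_le _ _).trans (add_le_add hsum hmain)
    _ = _ := by ring

/-- Weighted prime sums over `(z, Z]` with exponent below `-1`. -/
lemma abs_sum_rpow_neg_mul_log_sub_le {β : ℝ} (hβ : 1 < β) : ∃ C > 0, ∀ z Z : ℝ, 2 ≤ z → z ≤ Z →
    |∑ k ∈ Finset.Ioc ⌊z⌋₊ ⌊Z⌋₊, (k : ℝ) ^ (-β) * (if k.Prime then Real.log k else 0) -
      (z ^ (1 - β) - Z ^ (1 - β)) / (β - 1)| ≤ C * (z ^ (1 - β) / Real.log z) := by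
  obtain ⟨C, hC0, hC⟩ := abs_theta_sub_le
  have hβ1 : 0 < β - 1 := by linarith
  refine ⟨C * (2 + β / (β - 1)), by positivity, fun z Z hz hzZ => ?_⟩
  have hz0 : 0 < z := by linarith
  have hZ0 : 0 < Z := by linarith
  have hlz : 0 < Real.log z := Real.log_pos (by linarith)
  have hlZ : Real.log z ≤ Real.log Z := Real.log_le_log hz0 hzZ
  have h1 := abs_sum_rpow_mul_log_sub_le hC hz hzZ (γ := -β) (by linarith)
  have hpow : Z ^ (1 - β) ≤ z ^ (1 - β) :=
    Real.rpow_le_rpow_of_nonpos hz0 hzZ (by linarith)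
  have hpos : 0 ≤ Z ^ (1 - β) := by positivity
  have h2 : ∫ t in z..Z, t ^ (-β) / Real.log t ≤ z ^ (1 - β) / (β - 1) / Real.log z := by
    have hsub : uIcc z Z = Icc z Z := uIcc_of_le hzZ
    have i1 : IntervalIntegrable (fun t => t ^ (-β)) volume z Z :=
      ContinuousOn.intervalIntegrable (by rw [hsub]; exact continuousOn_rpow_Icc hz0 _)
    have i2 : IntervalIntegrable (fun t => t ^ (-β) / Real.log t) volume z Z :=
      ContinuousOn.intervalIntegrable (by
        rw [hsub]
        refine (continuousOn_rpow_Icc hz0 _).div (fun t ht => ?_) fun t ht => ?_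
        · exact (Real.continuousAt_log (by linarith [ht.1])).continuousWithinAt
        · exact (Real.log_pos (by linarith [ht.1])).ne')
    calc _ ≤ ∫ t in z..Z, t ^ (-β) / Real.log z := by
          refine intervalIntegral.integral_mono_on hzZ i2 (i1.div_const _) fun t ht => ?_
          have ht0 : 0 < t := by linarith [ht.1]
          have := Real.log_le_log hz0 ht.1
          gcongr
      _ = (z ^ (1 - β) - Z ^ (1 - β)) / (β - 1) / Real.log z := by
          rw [intervalIntegral.integral_div, integral_rpow]
          · rw [show -β + 1 = -(β - 1) by ring, div_neg, ← neg_div, neg_sub, neg_sub]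
          · right
            refine ⟨by linarith, ?_⟩
            rw [hsub]
            exact fun h => by linarith [h.1]
      _ ≤ _ := by gcongr; linarith
  have e1 : (Z ^ (-β + 1) - z ^ (-β + 1)) / (-β + 1) = (z ^ (1 - β) - Z ^ (1 - β)) / (β - 1) := by
    rw [show -β + 1 = -(β - 1) by ring, div_neg, ← neg_div, neg_sub, neg_sub]
  rw [e1, abs_neg, abs_of_pos (by linarith : 0 < β), show -β + 1 = 1 - β by ring] at h1
  refine h1.trans ?_
  calc _ ≤ C * (z ^ (1 - β) / Real.log z + z ^ (1 - β) / Real.log z +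
        β * (z ^ (1 - β) / (β - 1) / Real.log z)) := by gcongr
    _ = _ := by field_simp; ring

lemma abs_four_div_sq_sub_le {L l : ℝ} (hL : 0 < L) (h0 : L / 3 ≤ l) (h1 : l ≤ L / 2)
    (h2 : (l - L / 3) ^ 2 ≤ L) : |4 / (L - l) ^ 2 - 27 * l / L ^ 3| ≤ 108 / L ^ 3 := by
  have hM : L / 2 ≤ L - l := by linarith
  have hM0 : 0 < L - l := by linarith
  have e : 4 / (L - l) ^ 2 - 27 * l / L ^ 3 =
      9 * (l - L / 3) ^ 2 * (4 * L - 3 * l) / ((L - l) ^ 2 * L ^ 3) := by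
    field_simp
    ring
  have h3 : 0 ≤ 4 * L - 3 * l := by linarith
  rw [e, abs_of_nonneg (by positivity)]
  calc _ ≤ 9 * L * (4 * L - 3 * (L / 3)) / ((L / 2) ^ 2 * L ^ 3) := by
        gcongr
        nlinarith
    _ = _ := by field_simp; norm_num

/-- The contribution of a single outer prime `p` near `x ^ (1 / 3)`, up to logarithmic powers. -/
lemma abs_rpow_neg_mul_sum_sum_sub_le {α : ℝ} (hα : 0 < α) : ∃ C > 0, ∀ x p : ℝ, 0 < x → 0 < p →
    36 ≤ Real.log x → Real.log x / 3 ≤ Real.log p → Real.log p ≤ Real.log x / 2 →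
    (Real.log p - Real.log x / 3) ^ 2 ≤ Real.log x →
    |p ^ (-α) * ∑ p₂ ∈ primesUpTo √(x / p), ∑ q ∈ (Finset.range p₂).filter Nat.Prime, (q : ℝ) ^ α -
      27 / ((α + 1) * (α + 2)) * (x ^ (1 + α / 2) / Real.log x ^ 3) *
        (p ^ (-(1 + 3 * α / 2)) * Real.log p)| ≤
      C * (x ^ (1 + α / 2) / Real.log x ^ 4) * (p ^ (-(1 + 3 * α / 2)) * Real.log p) := by
  obtain ⟨C, hC0, hC⟩ := abs_sum_sum_rpow_sub_le hα
  refine ⟨3 * (64 * C + 108 / ((α + 1) * (α + 2))), by positivity, ?_⟩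
  intro x p hx hp hL36 h1 h2 h3
  set L := Real.log x with hLdef
  set l := Real.log p with hl
  have hL : 0 < L := by linarith
  set y := √(x / p) with hy
  have hxp : 0 < x / p := by positivity
  have hy0 : 0 < y := Real.sqrt_pos.2 hxp
  have hly : Real.log y = (L - l) / 2 := by
    rw [hy, Real.log_sqrt hxp.le, Real.log_div hx.ne' hp.ne']
  have hly4 : L / 4 ≤ Real.log y := by rw [hly]; linarith
  have hy2 : 2 ≤ y := by
    rw [← Real.log_le_log_iff (by norm_num) hy0]
    linarith [Real.log_two_lt_d9]
  have hypow : p ^ (-α) * y ^ (α + 2) = x ^ (1 + α / 2) * p ^ (-(1 + 3 * α / 2)) := by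
    rw [hy, Real.sqrt_eq_rpow, ← Real.rpow_mul hxp.le, Real.div_rpow hx.le hp.le, div_eq_mul_inv,
      ← Real.rpow_neg hp.le, mul_left_comm, ← Real.rpow_add hp]
    congr 2 <;> ring
  set P := x ^ (1 + α / 2) * p ^ (-(1 + 3 * α / 2)) with hP
  have hP0 : 0 < P := by positivity
  have hpα : 0 < p ^ (-α) := by positivity
  set S := ∑ p₂ ∈ primesUpTo y, ∑ q ∈ (Finset.range p₂).filter Nat.Prime, (q : ℝ) ^ α
  have b1 : |p ^ (-α) * (S - y ^ (α + 2) / ((α + 1) * (α + 2) * Real.log y ^ 2))| ≤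
      64 * C * (P / L ^ 3) := by
    rw [abs_mul, abs_of_pos hpα]
    calc _ ≤ p ^ (-α) * (C * (y ^ (α + 2) / Real.log y ^ 3)) := by gcongr; exact hC y hy2
      _ ≤ p ^ (-α) * (C * (y ^ (α + 2) / (L / 4) ^ 3)) := by gcongr
      _ = 64 * C * ((p ^ (-α) * y ^ (α + 2)) / L ^ 3) := by field_simp; norm_num
      _ = _ := by rw [hypow]
  have b2 : |P / ((α + 1) * (α + 2)) * (4 / (L - l) ^ 2 - 27 * l / L ^ 3)| ≤
      108 / ((α + 1) * (α + 2)) * (P / L ^ 3) := by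
    rw [abs_mul, abs_of_pos (by positivity : 0 < P / ((α + 1) * (α + 2)))]
    calc _ ≤ P / ((α + 1) * (α + 2)) * (108 / L ^ 3) := by
          gcongr; exact abs_four_div_sq_sub_le hL h1 h2 h3
      _ = _ := by field_simp
  have hLl : L - l ≠ 0 := by linarith
  calc _ = |p ^ (-α) * (S - y ^ (α + 2) / ((α + 1) * (α + 2) * Real.log y ^ 2)) +
        P / ((α + 1) * (α + 2)) * (4 / (L - l) ^ 2 - 27 * l / L ^ 3)| := by
        congr 1
        rw [mul_sub, ← mul_div_assoc (p ^ (-α)) (y ^ (α + 2)), hypow, hly, hP]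
        field_simp
        ring
    _ ≤ (64 * C + 108 / ((α + 1) * (α + 2))) * (P / L ^ 3) := by
        refine (abs_add_le _ _).trans ((add_le_add b1 b2).trans (le_of_eq (by ring)))
    _ = 3 * (64 * C + 108 / ((α + 1) * (α + 2))) * (P / L ^ 4) * (L / 3) := by field_simp
    _ ≤ 3 * (64 * C + 108 / ((α + 1) * (α + 2))) * (P / L ^ 4) * l := by gcongr
    _ = _ := by rw [hP]; ring

lemma filter_prime_gt_eq {z Z : ℝ} (hz : 0 ≤ z) :
    (Finset.Icc 2 ⌊Z⌋₊).filter (fun p : ℕ => p.Prime ∧ z < (p : ℝ)) =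
      (Finset.Ioc ⌊z⌋₊ ⌊Z⌋₊).filter Nat.Prime := by
  ext p
  simp only [Finset.mem_filter, Finset.mem_Icc, Finset.mem_Ioc, ← Nat.floor_lt hz]
  constructor
  · rintro ⟨⟨_, h2⟩, h3, h4⟩
    exact ⟨⟨h4, h2⟩, h3⟩
  · rintro ⟨⟨h4, h2⟩, h3⟩
    exact ⟨⟨h3.two_le, h2⟩, h3, h4⟩

/-- The weighted prime sum over `x ^ (1 / 3) < p ≤ x ^ (1 / 3) * (log x) ^ (4 / α)`. -/
lemma abs_sum_filter_rpow_neg_mul_log_sub_le {α : ℝ} (hα : 0 < α) : ∃ C > 0, ∀ x : ℝ, 0 < x →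
    36 ≤ Real.log x →
    |∑ p ∈ (Finset.Icc 2 ⌊x ^ ((1:ℝ) / 3) * Real.log x ^ ((4:ℝ) / α)⌋₊).filter
        (fun p : ℕ => p.Prime ∧ x ^ ((1:ℝ) / 3) < (p : ℝ)),
        (p : ℝ) ^ (-(1 + 3 * α / 2)) * Real.log p - 2 / (3 * α) * x ^ (-(α / 2))| ≤
      C * (x ^ (-(α / 2)) / Real.log x) := by
  obtain ⟨C, hC0, hC⟩ := abs_sum_rpow_neg_mul_log_sub_le (β := 1 + 3 * α / 2) (by linarith)
  refine ⟨3 * C + 2 / (3 * α), by positivity, fun x hx hL36 => ?_⟩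
  set L := Real.log x with hLdef
  have hL : 0 < L := by linarith
  set z := x ^ ((1:ℝ) / 3) with hz
  set W := L ^ ((4:ℝ) / α) with hW
  have hz0 : 0 < z := by positivity
  have hW1 : 1 ≤ W := Real.one_le_rpow (by linarith) (by positivity)
  have hlz : Real.log z = L / 3 := by rw [hz, Real.log_rpow hx]; ring
  have hz2 : 2 ≤ z := by
    rw [← Real.log_le_log_iff (by norm_num) hz0]
    linarith [Real.log_two_lt_d9]
  have hzZ : z ≤ z * W := le_mul_of_one_le_right hz0.le hW1
  have h1 := hC z (z * W) hz2 hzZ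
  have e0 : (1 : ℝ) - (1 + 3 * α / 2) = -(3 * α / 2) := by ring
  have e1 : z ^ (-(3 * α / 2)) = x ^ (-(α / 2)) := by
    rw [hz, ← Real.rpow_mul hx.le]; congr 1; ring
  have e2 : W ^ (-(3 * α / 2)) = 1 / L ^ 6 := by
    rw [hW, ← Real.rpow_mul hL.le, show 4 / α * -(3 * α / 2) = -((6 : ℕ) : ℝ) by field_simp; norm_num,
      Real.rpow_neg hL.le, Real.rpow_natCast, one_div]
  have e3 : W ^ (-(3 * α / 2)) ≤ 1 / L := by
    rw [e2]
    gcongr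
    exact le_self_pow₀ (by linarith) (by norm_num)
  rw [e0, Real.mul_rpow hz0.le (by linarith), e1, hlz, add_sub_cancel_left] at h1
  rw [filter_prime_gt_eq hz0.le, Finset.sum_filter]
  simp only [mul_ite, mul_zero] at h1
  set T := ∑ k ∈ Finset.Ioc ⌊z⌋₊ ⌊z * W⌋₊,
    (if k.Prime then (k : ℝ) ^ (-(1 + 3 * α / 2)) * Real.log k else 0) with hT
  have hV0 : 0 < W ^ (-(3 * α / 2)) := by positivity
  set V := W ^ (-(3 * α / 2))
  set X := x ^ (-(α / 2)) with hX
  have hX0 : 0 < X := by positivity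
  have e4 : (X - X * V) / (3 * α / 2) = 2 / (3 * α) * X - 2 / (3 * α) * (X * V) := by
    field_simp
  have e5 : 2 / (3 * α) * (X * V) ≤ 2 / (3 * α) * (X / L) := by
    rw [div_eq_mul_one_div X L]; gcongr
  have e6 : 0 ≤ 2 / (3 * α) * (X * V) := by positivity
  have e7 : C * (X / (L / 3)) = 3 * C * (X / L) := by field_simp
  have e8 : 0 < C * (X / L) := by positivity
  have e9 : 0 < 2 / (3 * α) * (X / L) := by positivity
  rw [e4, e7, abs_le] at h1
  rw [abs_le]
  constructor <;> linarith

lemma eventually_log_log_le {α : ℝ} (hα : 0 < α) :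
    ∀ᶠ x : ℝ in atTop, 4 / α * Real.log (Real.log x) ≤ √(Real.log x) := by
  have h := ((isLittleO_log_rpow_atTop (r := 1 / 2) (by norm_num)).comp_tendsto
    Real.tendsto_log_atTop).bound (c := α / 4) (by positivity)
  filter_upwards [h, Real.tendsto_log_atTop.eventually_ge_atTop 1] with x hx hx1
  simp only [Function.comp_apply, ← Real.sqrt_eq_rpow] at hx
  rw [Real.norm_of_nonneg (Real.log_nonneg hx1), Real.norm_of_nonneg (Real.sqrt_nonneg _)] at hx
  calc _ ≤ 4 / α * (α / 4 * √(Real.log x)) := by gcongr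
    _ = _ := by field_simp

end

open Filter Finset

/-- For `α > 0`,
`Σ_{x^{1/3} < p₃ ≤ x^{1/3}(log x)^{4/α}} p₃^{-α} Σ_{p₂ ≤ √(x/p₃)} Σ_{p₁ < p₂} p₁^α
  = (18/(α(α+1)(α+2)))·x/log³x + O(x/log⁴x)`, the sums ranging over primes. -/
theorem I4_asymptotic (α : ℝ) (hα : 0 < α) :
    (fun x : ℝ =>
        (∑ p3 ∈ (Finset.Icc 2 ⌊x ^ ((1:ℝ) / 3) * Real.log x ^ ((4:ℝ) / α)⌋₊).filter
            (fun p3 : ℕ => p3.Prime ∧ x ^ ((1:ℝ) / 3) < (p3 : ℝ)),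
            (p3 : ℝ) ^ (-α) *
              ∑ p2 ∈ (Finset.Icc 2 ⌊Real.sqrt (x / (p3 : ℝ))⌋₊).filter Nat.Prime,
                ∑ p1 ∈ (Finset.range p2).filter Nat.Prime, (p1 : ℝ) ^ α)
        - (18 / (α * (α + 1) * (α + 2))) * (x / Real.log x ^ 3))
      =O[atTop] (fun x : ℝ => x / Real.log x ^ 4) := by
  obtain ⟨C, hC0, hC⟩ := abs_rpow_neg_mul_sum_sum_sub_le hα
  obtain ⟨K, hK0, hK⟩ := abs_sum_filter_rpow_neg_mul_log_sub_le hα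
  set D : ℝ := 27 / ((α + 1) * (α + 2)) with hD
  refine Asymptotics.IsBigO.of_bound (C * (2 / (3 * α) + K) + D * K) ?_
  filter_upwards [eventually_log_log_le hα, Real.tendsto_log_atTop.eventually_ge_atTop 36,
    eventually_gt_atTop 0] with x hll hL36 hx
  have hT := hK x hx hL36
  set A := (Finset.Icc 2 ⌊x ^ ((1:ℝ) / 3) * Real.log x ^ ((4:ℝ) / α)⌋₊).filter
    (fun p : ℕ => p.Prime ∧ x ^ ((1:ℝ) / 3) < (p : ℝ)) with hA
  have hterm : ∀ p ∈ A, |(p : ℝ) ^ (-α) *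
      ∑ p₂ ∈ primesUpTo √(x / p), ∑ q ∈ (Finset.range p₂).filter Nat.Prime, (q : ℝ) ^ α -
      D * (x ^ (1 + α / 2) / Real.log x ^ 3) * ((p : ℝ) ^ (-(1 + 3 * α / 2)) * Real.log p)| ≤
      C * (x ^ (1 + α / 2) / Real.log x ^ 4) *
        ((p : ℝ) ^ (-(1 + 3 * α / 2)) * Real.log p) := by
    intro p hp
    simp only [hA, Finset.mem_filter, Finset.mem_Icc] at hp
    obtain ⟨⟨hp2, hpZ⟩, hpp, hpz⟩ := hp
    have hp0 : (0:ℝ) < p := by exact_mod_cast hpp.pos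
    have hL : 0 < Real.log x := by linarith
    have hz0 : 0 < x ^ ((1:ℝ) / 3) := by positivity
    have hW0 : 0 < Real.log x ^ ((4:ℝ) / α) := by positivity
    have hpZ' : (p : ℝ) ≤ x ^ ((1:ℝ) / 3) * Real.log x ^ ((4:ℝ) / α) :=
      (Nat.le_floor_iff' hpp.ne_zero).1 hpZ
    have hlow := Real.log_le_log hz0 hpz.le
    have hupp := Real.log_le_log hp0 hpZ'
    rw [Real.log_mul hz0.ne' hW0.ne', Real.log_rpow hL] at hupp
    rw [Real.log_rpow hx] at hupp hlow
    have hs := Real.mul_self_sqrt hL.le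
    have hs6 : 6 ≤ √(Real.log x) := Real.le_sqrt_of_sq_le (by linarith)
    refine hC x p hx hp0 hL36 (by linarith) (by nlinarith) ?_
    have h5 : Real.log p - Real.log x / 3 ≤ √(Real.log x) := by linarith
    have h6 : 0 ≤ Real.log p - Real.log x / 3 := by linarith
    nlinarith
  set T := ∑ p ∈ A, (p : ℝ) ^ (-(1 + 3 * α / 2)) * Real.log p with hTdef
  set L := Real.log x
  have hL : 0 < L := by linarith
  have hsum : |∑ p ∈ A, (p : ℝ) ^ (-α) *
      ∑ p₂ ∈ primesUpTo √(x / p), ∑ q ∈ (Finset.range p₂).filter Nat.Prime, (q : ℝ) ^ α -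
      D * (x ^ (1 + α / 2) / L ^ 3) * T| ≤ C * (x ^ (1 + α / 2) / L ^ 4) * T := by
    rw [hTdef, Finset.mul_sum, Finset.mul_sum, ← Finset.sum_sub_distrib]
    exact (Finset.abs_sum_le_sum_abs _ _).trans (Finset.sum_le_sum hterm)
  have hX : x ^ (1 + α / 2) * x ^ (-(α / 2)) = x := by
    rw [← Real.rpow_add hx, add_neg_cancel_right, Real.rpow_one]
  have hX0 : 0 < x ^ (-(α / 2)) := by positivity
  have hTle : T ≤ (2 / (3 * α) + K) * x ^ (-(α / 2)) := by
    have h1 := (abs_le.1 hT).2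
    have h2 : K * (x ^ (-(α / 2)) / L) ≤ K * (x ^ (-(α / 2)) / 1) := by gcongr; linarith
    rw [div_one] at h2
    linarith
  have b1 : C * (x ^ (1 + α / 2) / L ^ 4) * T ≤ C * (2 / (3 * α) + K) * (x / L ^ 4) := by
    calc _ ≤ C * (x ^ (1 + α / 2) / L ^ 4) * ((2 / (3 * α) + K) * x ^ (-(α / 2))) := by gcongr
      _ = C * (2 / (3 * α) + K) * ((x ^ (1 + α / 2) * x ^ (-(α / 2))) / L ^ 4) := by ring
      _ = _ := by rw [hX]
  have b2 : |D * (x ^ (1 + α / 2) / L ^ 3) * (T - 2 / (3 * α) * x ^ (-(α / 2)))| ≤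
      D * K * (x / L ^ 4) := by
    rw [abs_mul, abs_of_pos (by positivity : 0 < D * (x ^ (1 + α / 2) / L ^ 3))]
    calc _ ≤ D * (x ^ (1 + α / 2) / L ^ 3) * (K * (x ^ (-(α / 2)) / L)) := by gcongr
      _ = D * K * ((x ^ (1 + α / 2) * x ^ (-(α / 2))) / L ^ 4) := by field_simp
      _ = _ := by rw [hX]
  have e : D * (x ^ (1 + α / 2) / L ^ 3) * (2 / (3 * α) * x ^ (-(α / 2))) =
      18 / (α * (α + 1) * (α + 2)) * (x / L ^ 3) := by
    calc _ = D * (2 / (3 * α)) * ((x ^ (1 + α / 2) * x ^ (-(α / 2))) / L ^ 3) := by ring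
      _ = _ := by rw [hX, hD]; field_simp; norm_num
  rw [Real.norm_eq_abs, Real.norm_of_nonneg (by positivity)]
  calc _ = |(∑ p ∈ A, (p : ℝ) ^ (-α) *
      ∑ p₂ ∈ primesUpTo √(x / p), ∑ q ∈ (Finset.range p₂).filter Nat.Prime, (q : ℝ) ^ α -
      D * (x ^ (1 + α / 2) / L ^ 3) * T) +
      D * (x ^ (1 + α / 2) / L ^ 3) * (T - 2 / (3 * α) * x ^ (-(α / 2)))| := by
        rw [← e, mul_sub, sub_add_sub_cancel]; rfl
    _ ≤ _ := (abs_add_le _ _).trans (add_le_add (hsum.trans b1) b2)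
    _ = _ := by ring
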